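/- arXiv:2109.03129 — 2 statements merged into one kernel-verified Lean document; each statement's English description precedes it below -/
import Mathlib

section
/- Let W be a graphon such that spr(W) ≥ spr(U) for every graphon U, and let f, g ∈ L²[0,1] be unit eigenfunctions of W for the eigenvalues μ := μ(W) and ν := ν(W), respectively. Then μ·f(x)² − ν·g(x)² = μ − ν for a.e. x ∈ [0,1]. -/
open MeasureTheory

/-- Lebesgue measure restricted to the unit square `[0,1]²`. -/
noncomputable def unitSq : Measure (ℝ × ℝ) :=
  volume.restrict (Set.Icc (0 : ℝ) 1 ×ˢ Set.Icc (0 : ℝ) 1)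

/-- Lebesgue measure restricted to the unit interval `[0,1]`. -/
noncomputable def unitInt : Measure ℝ := volume.restrict (Set.Icc (0 : ℝ) 1)

/-- A graphon: a measurable function with values in `[0,1]` which is symmetric
almost everywhere on `[0,1]²`. -/
def IsGraphon (W : ℝ → ℝ → ℝ) : Prop :=
  Measurable (Function.uncurry W) ∧ (∀ x y, W x y ∈ Set.Icc (0 : ℝ) 1) ∧
    (∀ᵐ p : ℝ × ℝ ∂unitSq, W p.1 p.2 = W p.2 p.1)

/-- A unit function of `L²[0,1]`: measurable with `∫₀¹ f² = 1`. -/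
def IsUnitL2 (f : ℝ → ℝ) : Prop :=
  Measurable f ∧ (∫ x in Set.Icc (0 : ℝ) 1, (f x) ^ 2) = 1

/-- The quadratic form `∫₀¹∫₀¹ W(x,y) f(x) f(y) dx dy`. -/
noncomputable def quadForm (W : ℝ → ℝ → ℝ) (f : ℝ → ℝ) : ℝ :=
  ∫ x in Set.Icc (0 : ℝ) 1, ∫ y in Set.Icc (0 : ℝ) 1, W x y * f x * f y

/-- `μ(W)`, the maximum eigenvalue of the kernel operator associated to `W`. -/
noncomputable def graphonMu (W : ℝ → ℝ → ℝ) : ℝ :=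
  sSup {r : ℝ | ∃ f : ℝ → ℝ, IsUnitL2 f ∧ r = quadForm W f}

/-- `ν(W)`, the minimum eigenvalue of the kernel operator associated to `W`. -/
noncomputable def graphonNu (W : ℝ → ℝ → ℝ) : ℝ :=
  sInf {r : ℝ | ∃ f : ℝ → ℝ, IsUnitL2 f ∧ r = quadForm W f}

/-- The spread `spr(W) = μ(W) − ν(W)` of a graphon. -/
noncomputable def graphonSpr (W : ℝ → ℝ → ℝ) : ℝ := graphonMu W - graphonNu W

/-- `f` is a `lam`-eigenfunction of the kernel operator of `W`. -/
def IsEigenfunction (W : ℝ → ℝ → ℝ) (lam : ℝ) (f : ℝ → ℝ) : Prop :=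
  ∀ᵐ x ∂unitInt, (∫ y in Set.Icc (0 : ℝ) 1, W x y * f y) = lam * f x


instance unitInt_isProb : IsProbabilityMeasure unitInt := by
  constructor
  simp [unitInt]

theorem unitSq_eq_prod : unitSq = unitInt.prod unitInt := by
  rw [unitSq, unitInt, Measure.prod_restrict]
  rfl

theorem exists_map_unitInt (m : Measure ℝ) [IsProbabilityMeasure m] :
    ∃ φ : ℝ → ℝ, Measurable φ ∧ unitInt.map φ = m := by
  obtain ⟨f, hf, hfm⟩ := Measure.exists_measurable_map_eq (Y := ℝ) m
  have hI : unitInt = (volume : Measure unitInterval).map Subtype.val := by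
    rw [unitInt]
    exact (map_comap_subtype_coe measurableSet_Icc volume).symm
  have hφ : Measurable (fun x : ℝ => f (Set.projIcc 0 1 zero_le_one x)) :=
    hf.comp continuous_projIcc.measurable
  refine ⟨_, hφ, ?_⟩
  rw [hI, Measure.map_map hφ measurable_subtype_coe, ← hfm]
  congr 1
  funext x
  simp

theorem IsUnitL2.integrable_sq {f : ℝ → ℝ} (hf : IsUnitL2 f) :
    Integrable (fun x => f x ^ 2) unitInt := by
  by_contra h
  have := integral_undef h
  have h2 := hf.2
  rw [← unitInt, this] at h2
  exact zero_ne_one h2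

theorem IsUnitL2.integrable {f : ℝ → ℝ} (hf : IsUnitL2 f) : Integrable f unitInt := by
  have h := (hf.integrable_sq).add (integrable_const (1 : ℝ))
  refine h.mono' hf.1.aestronglyMeasurable (Filter.Eventually.of_forall fun x => ?_)
  simp only [Real.norm_eq_abs, Pi.add_apply]
  nlinarith [sq_abs (f x), sq_nonneg (|f x| - 1), sq_nonneg (|f x|)]

theorem abs_quadForm_le {U : ℝ → ℝ → ℝ} (hU : IsGraphon U) {f : ℝ → ℝ} (hf : IsUnitL2 f) :
    |quadForm U f| ≤ 1 := by
  unfold quadForm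
  rw [← unitInt]
  have hsq := hf.integrable_sq
  have h1 : ∫ x, f x ^ 2 ∂unitInt = 1 := hf.2
  have hin : ∀ x, ‖∫ y, U x y * f x * f y ∂unitInt‖ ≤ (f x ^ 2 + 1) / 2 := by
    intro x
    have hb : Integrable (fun y => (f x ^ 2 + f y ^ 2) / 2) unitInt :=
      ((integrable_const _).add hsq).div_const 2
    have := norm_integral_le_of_norm_le (f := fun y => U x y * f x * f y) hb
      (Filter.Eventually.of_forall fun y => by
        have := hU.2.1 x y
        rw [Real.norm_eq_abs, abs_mul, abs_mul, abs_of_nonneg this.1]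
        have h3 : U x y * |f x| * |f y| ≤ |f x| * |f y| := by
          have : 0 ≤ |f x| * |f y| := by positivity
          nlinarith [(hU.2.1 x y).2]
        nlinarith [sq_abs (f x), sq_abs (f y), sq_nonneg (|f x| - |f y|)])
    refine this.trans (le_of_eq ?_)
    rw [integral_div, integral_add (integrable_const _) hsq, h1]
    simp
  have hb : Integrable (fun x => (f x ^ 2 + 1) / 2) unitInt :=
    (hsq.add (integrable_const _)).div_const 2
  have := norm_integral_le_of_norm_le hb (Filter.Eventually.of_forall hin)
  rw [Real.norm_eq_abs] at this
  refine this.trans (le_of_eq ?_)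
  rw [integral_div, integral_add hsq (integrable_const _), h1]
  simp

theorem quadForm_le_mu {U : ℝ → ℝ → ℝ} (hU : IsGraphon U) {f : ℝ → ℝ} (hf : IsUnitL2 f) :
    quadForm U f ≤ graphonMu U :=
  le_csSup ⟨1, by rintro r ⟨f, hf, rfl⟩; exact (abs_le.1 (abs_quadForm_le hU hf)).2⟩ ⟨f, hf, rfl⟩

theorem nu_le_quadForm {U : ℝ → ℝ → ℝ} (hU : IsGraphon U) {f : ℝ → ℝ} (hf : IsUnitL2 f) :
    graphonNu U ≤ quadForm U f :=
  csInf_le ⟨-1, by rintro r ⟨f, hf, rfl⟩; exact (abs_le.1 (abs_quadForm_le hU hf)).1⟩ ⟨f, hf, rfl⟩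

/-- Pulling back a graphon along a map with image measure `m`. -/
theorem quadForm_pullback {W : ℝ → ℝ → ℝ} (hW : IsGraphon W) {m : Measure ℝ}
    [IsProbabilityMeasure m] {φ : ℝ → ℝ} (hφ : Measurable φ) (hm : unitInt.map φ = m)
    {f : ℝ → ℝ} (hf : Measurable f) (c : ℝ) :
    quadForm (fun x y => W (φ x) (φ y)) (fun x => c * f (φ x)) =
      c ^ 2 * ∫ x, ∫ y, W x y * f x * f y ∂m ∂m := by
  unfold quadForm
  rw [← unitInt]
  have hmeas : Measurable (fun p : ℝ × ℝ => W p.1 p.2 * f p.1 * f p.2) :=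
    (hW.1.mul (hf.comp measurable_fst)).mul (hf.comp measurable_snd)
  have h1 : ∀ x, ∫ y, W (φ x) (φ y) * (c * f (φ x)) * (c * f (φ y)) ∂unitInt
      = c ^ 2 * ∫ y, W (φ x) y * f (φ x) * f y ∂m := by
    intro x
    rw [← hm, integral_map hφ.aemeasurable, ← integral_const_mul]
    · congr 1; funext y; ring
    · exact (hmeas.comp measurable_prodMk_left).aestronglyMeasurable
  simp_rw [h1]
  rw [integral_const_mul]
  congr 1
  have hsm : StronglyMeasurable (fun x => ∫ y, W x y * f x * f y ∂m) :=
    StronglyMeasurable.integral_prod_right (f := fun x y => W x y * f x * f y)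
      hmeas.stronglyMeasurable
  conv_rhs => rw [← hm]
  rw [integral_map hφ.aemeasurable (by rw [hm]; exact hsm.aestronglyMeasurable), hm]

theorem isGraphon_pullback {W : ℝ → ℝ → ℝ} (hW : IsGraphon W) {m : Measure ℝ}
    [IsProbabilityMeasure m] {φ : ℝ → ℝ} (hφ : Measurable φ) (hm : unitInt.map φ = m)
    (hac : m ≪ unitInt) : IsGraphon (fun x y => W (φ x) (φ y)) := by
  refine ⟨hW.1.comp ((hφ.comp measurable_fst).prodMk (hφ.comp measurable_snd)),
    fun x y => hW.2.1 _ _, ?_⟩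
  have h := hW.2.2
  rw [unitSq_eq_prod] at h ⊢
  have h2 : ∀ᵐ p : ℝ × ℝ ∂(m.prod m), W p.1 p.2 = W p.2 p.1 := (hac.prod hac).ae_le h
  rw [← hm, Measure.map_prod_map _ _ hφ hφ] at h2
  exact ae_of_ae_map (hφ.prodMap hφ).aemeasurable h2

theorem spread_ineq {W : ℝ → ℝ → ℝ} (hW : IsGraphon W)
    (hmax : ∀ U : ℝ → ℝ → ℝ, IsGraphon U → graphonSpr U ≤ graphonSpr W)
    {m : Measure ℝ} [IsProbabilityMeasure m] (hac : m ≪ unitInt)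
    {f g : ℝ → ℝ} (hf : Measurable f) (hg : Measurable g)
    (hfp : 0 < ∫ x, f x ^ 2 ∂m) (hgp : 0 < ∫ x, g x ^ 2 ∂m) :
    (∫ x, ∫ y, W x y * f x * f y ∂m ∂m) / (∫ x, f x ^ 2 ∂m)
      - (∫ x, ∫ y, W x y * g x * g y ∂m ∂m) / (∫ x, g x ^ 2 ∂m)
      ≤ graphonMu W - graphonNu W := by
  obtain ⟨φ, hφ, hm⟩ := exists_map_unitInt m
  have hU := isGraphon_pullback hW hφ hm hac
  have key : ∀ f : ℝ → ℝ, Measurable f → 0 < ∫ x, f x ^ 2 ∂m →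
      ∃ F, IsUnitL2 F ∧ quadForm (fun x y => W (φ x) (φ y)) F =
        (∫ x, ∫ y, W x y * f x * f y ∂m ∂m) / (∫ x, f x ^ 2 ∂m) := by
    intro f hf hfp
    set D := ∫ x, f x ^ 2 ∂m with hD
    have hs : (Real.sqrt D)⁻¹ ^ 2 = D⁻¹ := by rw [inv_pow, Real.sq_sqrt hfp.le]
    refine ⟨fun x => (Real.sqrt D)⁻¹ * f (φ x), ⟨(hf.comp hφ).const_mul _, ?_⟩, ?_⟩
    · rw [← unitInt]
      simp_rw [mul_pow, hs]
      rw [integral_const_mul]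
      have : ∫ x, f (φ x) ^ 2 ∂unitInt = D := by
        rw [hD, ← hm, integral_map hφ.aemeasurable (hf.pow_const 2).aestronglyMeasurable]
      rw [this, inv_mul_cancel₀ hfp.ne']
    · rw [quadForm_pullback hW hφ hm hf, hs]
      field_simp
  obtain ⟨F, hF, hF2⟩ := key f hf hfp
  obtain ⟨G, hG, hG2⟩ := key g hg hgp
  have h1 := quadForm_le_mu hU hF
  have h2 := nu_le_quadForm hU hG
  have h3 := hmax _ hU
  unfold graphonSpr at h3
  rw [hF2] at h1
  rw [hG2] at h2
  linarith

theorem int_inner {W : ℝ → ℝ → ℝ} (hW : IsGraphon W)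
    {v : ℝ → ℝ} (hv : Integrable v unitInt) (x : ℝ) :
    Integrable (fun y => W x y * v y) unitInt := by
  refine hv.norm.mono' ((hW.1.comp measurable_prodMk_left).aestronglyMeasurable.mul hv.1)
    (Filter.Eventually.of_forall fun y => ?_)
  have := hW.2.1 x y
  rw [norm_mul, Real.norm_of_nonneg this.1]
  exact mul_le_of_le_one_left (norm_nonneg _) this.2

theorem int_prod {W : ℝ → ℝ → ℝ} (hW : IsGraphon W)
    {u v : ℝ → ℝ} (hu : Integrable u unitInt) (hv : Integrable v unitInt) :
    Integrable (fun p : ℝ × ℝ => u p.1 * (W p.1 p.2 * v p.2)) (unitInt.prod unitInt) := by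
  have h := hu.mul_prod hv
  refine h.norm.mono' ?_ (Filter.Eventually.of_forall fun p => ?_)
  · exact hu.1.comp_fst.mul (hW.1.aestronglyMeasurable.mul hv.1.comp_snd)
  · have := hW.2.1 p.1 p.2
    rw [norm_mul, norm_mul, Real.norm_of_nonneg this.1, norm_mul]
    exact mul_le_mul_of_nonneg_left (mul_le_of_le_one_left (norm_nonneg _) this.2) (norm_nonneg _)

theorem int_outer {W : ℝ → ℝ → ℝ} (hW : IsGraphon W)
    {u v : ℝ → ℝ} (hu : Integrable u unitInt) (hv : Integrable v unitInt) :
    Integrable (fun x => u x * ∫ y, W x y * v y ∂unitInt) unitInt := by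
  have := (int_prod hW hu hv).integral_prod_left
  simpa only [integral_const_mul] using this

theorem bil_symm {W : ℝ → ℝ → ℝ} (hW : IsGraphon W)
    {u v : ℝ → ℝ} (hu : Integrable u unitInt) (hv : Integrable v unitInt) :
    ∫ x, u x * ∫ y, W x y * v y ∂unitInt ∂unitInt =
      ∫ x, v x * ∫ y, W x y * u y ∂unitInt ∂unitInt := by
  have h1 := integral_prod _ (int_prod hW hu hv)
  have h2 := integral_prod_symm _ (int_prod hW hv hu)
  have hs := hW.2.2
  rw [unitSq_eq_prod] at hs
  simp only [integral_const_mul] at h1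
  rw [← h1]
  have h3 := integral_prod _ (int_prod hW hv hu)
  simp only [integral_const_mul] at h3
  rw [← h3, ← integral_prod_swap]
  refine integral_congr_ae ?_
  filter_upwards [hs] with p hp
  simp only [Prod.fst_swap, Prod.snd_swap]
  rw [hp]; ring

theorem bil_expand {W : ℝ → ℝ → ℝ} (hW : IsGraphon W)
    {f : ℝ → ℝ} (hf : IsUnitL2 f) {lam : ℝ} (hfe : IsEigenfunction W lam f)
    {A : Set ℝ} (hA : MeasurableSet A) : ∃ c : ℝ, ∀ t : ℝ,
    ∫ x, (f x + t * A.indicator f x) *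
      ∫ y, W x y * (f y + t * A.indicator f y) ∂unitInt ∂unitInt
      = lam + 2 * t * (lam * ∫ x in A, f x ^ 2 ∂unitInt) + t ^ 2 * c := by
  have hfi := hf.integrable
  have hai := hfi.indicator hA
  refine ⟨∫ x, A.indicator f x * ∫ y, W x y * A.indicator f y ∂unitInt ∂unitInt, fun t => ?_⟩
  have e1 : ∫ x, f x * ∫ y, W x y * f y ∂unitInt ∂unitInt = lam := by
    have : ∫ x, f x * ∫ y, W x y * f y ∂unitInt ∂unitInt = ∫ x, lam * f x ^ 2 ∂unitInt := by
      refine integral_congr_ae ?_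
      filter_upwards [hfe] with x hx
      rw [unitInt, hx]; ring
    rw [this, integral_const_mul]
    have h2 := hf.2
    rw [← unitInt] at h2
    rw [h2, mul_one]
  have e2 : ∫ x, A.indicator f x * ∫ y, W x y * f y ∂unitInt ∂unitInt
      = lam * ∫ x in A, f x ^ 2 ∂unitInt := by
    rw [← integral_const_mul, ← integral_indicator hA]
    refine integral_congr_ae ?_
    filter_upwards [hfe] with x hx
    by_cases hxA : x ∈ A
    · simp only [Set.indicator_of_mem hxA]
      rw [unitInt, hx]; ring
    · simp [Set.indicator_of_notMem hxA]
  have e3 := bil_symm hW hfi hai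
  rw [e2] at e3
  have hin : ∀ x, ∫ y, W x y * (f y + t * A.indicator f y) ∂unitInt =
      (∫ y, W x y * f y ∂unitInt) + t * ∫ y, W x y * A.indicator f y ∂unitInt := by
    intro x
    rw [← integral_const_mul, ← integral_add (int_inner hW hfi x)
      ((int_inner hW hai x).const_mul t)]
    congr 1; funext y; ring
  simp_rw [hin]
  have i1 := int_outer hW hfi hfi
  have i2 := int_outer hW hai hfi
  have i3 := int_outer hW hfi hai
  have i4 := int_outer hW hai hai
  have : ∀ x, (f x + t * A.indicator f x) * ((∫ y, W x y * f y ∂unitInt) +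
      t * ∫ y, W x y * A.indicator f y ∂unitInt) =
      ((f x * ∫ y, W x y * f y ∂unitInt) + t * (A.indicator f x * ∫ y, W x y * f y ∂unitInt)) +
      (t * (f x * ∫ y, W x y * A.indicator f y ∂unitInt) +
      t ^ 2 * (A.indicator f x * ∫ y, W x y * A.indicator f y ∂unitInt)) := by
    intro x; ring
  simp_rw [this]
  have j1 : Integrable (fun x => (f x * ∫ y, W x y * f y ∂unitInt) +
      t * (A.indicator f x * ∫ y, W x y * f y ∂unitInt)) unitInt := i1.add (i2.const_mul t)
  have j2 : Integrable (fun x => t * (f x * ∫ y, W x y * A.indicator f y ∂unitInt) +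
      t ^ 2 * (A.indicator f x * ∫ y, W x y * A.indicator f y ∂unitInt)) unitInt :=
    (i3.const_mul t).add (i4.const_mul _)
  rw [integral_add j1 j2,
    integral_add i1 (i2.const_mul t), integral_add (i3.const_mul t) (i4.const_mul _),
    integral_const_mul, integral_const_mul, integral_const_mul, e1, e2, e3]
  ring

theorem perturb_ineq {W : ℝ → ℝ → ℝ} (hW : IsGraphon W)
    (hmax : ∀ U : ℝ → ℝ → ℝ, IsGraphon U → graphonSpr U ≤ graphonSpr W)
    {f g : ℝ → ℝ} (hf : IsUnitL2 f) (hg : IsUnitL2 g)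
    {A : Set ℝ} (hA : MeasurableSet A) {t : ℝ} (ht : -1 < t) {mu nu p q a cf cg : ℝ}
    (hmu : graphonMu W = mu) (hnu : graphonNu W = nu)
    (hp : ∫ x in A, f x ^ 2 ∂unitInt = p) (hq : ∫ x in A, g x ^ 2 ∂unitInt = q)
    (ha : unitInt.real A = a)
    (hcf : ∫ x, (f x + t * A.indicator f x) *
      ∫ y, W x y * (f y + t * A.indicator f y) ∂unitInt ∂unitInt = cf)
    (hcg : ∫ x, (g x + t * A.indicator g x) *
      ∫ y, W x y * (g y + t * A.indicator g y) ∂unitInt ∂unitInt = cg) :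
    cf * (1 + t * q) - cg * (1 + t * p) ≤ (mu - nu) * (1 + t * a) * (1 + t * p) * (1 + t * q) := by
  have hpos : ∀ r : ℝ, 0 ≤ r → r ≤ 1 → 0 < 1 + t * r := by
    intro r h0 h1
    rcases h0.eq_or_lt with h | h
    · simp [← h]
    · nlinarith [mul_pos h (by linarith : (0 : ℝ) < 1 + t)]
  have hl : ∀ f : ℝ → ℝ, IsUnitL2 f → 0 < 1 + t * ∫ x in A, f x ^ 2 ∂unitInt := by
    intro f hf
    refine hpos _ (integral_nonneg fun x => sq_nonneg _) ?_
    have h2 : ∫ x, f x ^ 2 ∂unitInt = 1 := hf.2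
    rw [← h2]
    exact setIntegral_le_integral hf.integrable_sq
      (Filter.Eventually.of_forall fun x => sq_nonneg _)
  have hapos : 0 < 1 + t * a := by
    rw [← ha]
    exact hpos _ measureReal_nonneg measureReal_le_one
  set s := (1 + t * a)⁻¹ with hs
  have hspos : 0 < s := inv_pos.2 hapos
  set k : ℝ → ℝ := fun x => s * (1 + t * A.indicator 1 x) with hk
  have hkm : Measurable k :=
    (((measurable_one.indicator hA).const_mul t).const_add 1).const_mul s
  have hk0 : ∀ x, 0 ≤ k x := by
    intro x
    refine mul_nonneg hspos.le (hpos _ ?_ ?_).le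
    · exact Set.indicator_nonneg (fun _ _ => zero_le_one) x
    · exact Set.indicator_le_self' (fun _ _ => zero_le_one) x
  have hAi : Integrable (A.indicator (1 : ℝ → ℝ)) unitInt :=
    (integrable_const (1 : ℝ)).indicator hA
  have hki : Integrable k unitInt := ((integrable_const 1).add (hAi.const_mul t)).const_mul s
  have hkint : ∫ x, k x ∂unitInt = 1 := by
    rw [hk, integral_const_mul, integral_add (integrable_const 1) (hAi.const_mul t),
      integral_const_mul, integral_indicator_one hA, ha]
    simp
    exact inv_mul_cancel₀ hapos.ne'
  set m := unitInt.withDensity (fun x => ENNReal.ofReal (k x)) with hm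
  have hmp : IsProbabilityMeasure m := by
    constructor
    rw [hm, withDensity_apply _ MeasurableSet.univ, Measure.restrict_univ,
      ← ofReal_integral_eq_lintegral_ofReal hki (Filter.Eventually.of_forall hk0), hkint]
    simp
  have hmi : ∀ F : ℝ → ℝ, ∫ x, F x ∂m = ∫ x, k x * F x ∂unitInt := by
    intro F
    rw [hm, integral_withDensity_eq_integral_toReal_smul hkm.ennreal_ofReal
      (Filter.Eventually.of_forall fun x => ENNReal.ofReal_lt_top)]
    congr 1; funext x
    rw [ENNReal.toReal_ofReal (hk0 x), smul_eq_mul]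
  have hsq : ∀ f : ℝ → ℝ, IsUnitL2 f →
      ∫ x, f x ^ 2 ∂m = s * (1 + t * ∫ x in A, f x ^ 2 ∂unitInt) := by
    intro f hf
    rw [hmi]
    have h2 : ∫ x, f x ^ 2 ∂unitInt = 1 := hf.2
    have : ∀ x, k x * f x ^ 2 = s * (f x ^ 2 + t * A.indicator (fun x => f x ^ 2) x) := by
      intro x
      by_cases hx : x ∈ A <;> simp [hk, hx] <;> ring
    simp_rw [this]
    rw [integral_const_mul, integral_add hf.integrable_sq
      ((hf.integrable_sq.indicator hA).const_mul t), integral_const_mul, integral_indicator hA, h2]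
  have hqf : ∀ f : ℝ → ℝ, ∫ x, ∫ y, W x y * f x * f y ∂m ∂m =
      s ^ 2 * ∫ x, (f x + t * A.indicator f x) *
      ∫ y, W x y * (f y + t * A.indicator f y) ∂unitInt ∂unitInt := by
    intro f
    have hkf : ∀ x, k x * f x = s * (f x + t * A.indicator f x) := by
      intro x
      by_cases hx : x ∈ A <;> simp [hk, hx] <;> ring
    rw [hmi, ← integral_const_mul]
    congr 1; funext x
    rw [hmi]
    have : ∀ y, k y * (W x y * f x * f y) =
        (s * f x) * (W x y * (f y + t * A.indicator f y)) := by
      intro y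
      linear_combination (W x y * f x) * hkf y
    simp_rw [this]
    rw [integral_const_mul]
    linear_combination (s * ∫ y, W x y * (f y + t * A.indicator f y) ∂unitInt) * hkf x
  have hfl := hl f hf
  have hgl := hl g hg
  have main := spread_ineq hW hmax (m := m) (withDensity_absolutelyContinuous _ _) hf.1 hg.1
    (by rw [hsq f hf]; positivity) (by rw [hsq g hg]; positivity)
  rw [hsq f hf, hsq g hg, hqf, hqf, hcf, hcg, hp, hq, hmu, hnu] at main
  rw [hp] at hfl
  rw [hq] at hgl
  have e : s ^ 2 * cf / (s * (1 + t * p)) - s ^ 2 * cg / (s * (1 + t * q)) =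
      (cf * (1 + t * q) - cg * (1 + t * p)) / ((1 + t * a) * (1 + t * p) * (1 + t * q)) := by
    rw [hs]
    field_simp
  rw [e, div_le_iff₀ (by positivity)] at main
  linarith

/-- A cubic polynomial nonnegative near `0` and vanishing at `0` has zero derivative there. -/
theorem linear_coeff_zero {b c d : ℝ}
    (h : ∀ t : ℝ, -1 < t → t < 1 → 0 ≤ t * b + t ^ 2 * c + t ^ 3 * d) : b = 0 := by
  have hmin : IsLocalMin (fun t : ℝ => t * b + t ^ 2 * c + t ^ 3 * d) 0 := by
    filter_upwards [Ioo_mem_nhds (show (-1 : ℝ) < 0 by norm_num) (show (0 : ℝ) < 1 by norm_num)]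
      with t ht
    simpa using h t ht.1 ht.2
  have hd : HasDerivAt (fun t : ℝ => t * b + t ^ 2 * c + t ^ 3 * d) b 0 := by
    have h1 := (((hasDerivAt_id' (0 : ℝ)).mul_const b).add
      ((hasDerivAt_pow 2 (0 : ℝ)).mul_const c)).add ((hasDerivAt_pow 3 (0 : ℝ)).mul_const d)
    refine h1.congr_deriv ?_
    simp
  exact hmin.hasDerivAt_eq_zero hd

/-- The local eigenfunction equation: for a spread-maximal graphon `W` with extremal
unit eigenfunctions `f, g`, `μ f(x)² − ν g(x)² = μ − ν` almost everywhere. -/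
theorem graphon_local_eigenfunction_equation (W : ℝ → ℝ → ℝ) (hW : IsGraphon W)
    (hmax : ∀ U : ℝ → ℝ → ℝ, IsGraphon U → graphonSpr U ≤ graphonSpr W)
    (f g : ℝ → ℝ) (hf : IsUnitL2 f) (hg : IsUnitL2 g)
    (hfe : IsEigenfunction W (graphonMu W) f)
    (hge : IsEigenfunction W (graphonNu W) g) :
    ∀ᵐ x ∂unitInt,
      graphonMu W * f x ^ 2 - graphonNu W * g x ^ 2 = graphonMu W - graphonNu W := by
  have i1 := hf.integrable_sq.const_mul (graphonMu W)
  have i2 := hg.integrable_sq.const_mul (graphonNu W)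
  refine Integrable.ae_eq_of_forall_setIntegral_eq _ _ (i1.sub i2) (integrable_const _) ?_
  intro A hA _
  rw [setIntegral_const, smul_eq_mul]
  have : ∫ x in A, (graphonMu W * f x ^ 2 - graphonNu W * g x ^ 2) ∂unitInt =
      graphonMu W * (∫ x in A, f x ^ 2 ∂unitInt) - graphonNu W * ∫ x in A, g x ^ 2 ∂unitInt := by
    rw [integral_sub i1.integrableOn i2.integrableOn, integral_const_mul, integral_const_mul]
  rw [this]
  obtain ⟨cf, hcf⟩ := bil_expand hW hf hfe hA
  obtain ⟨cg, hcg⟩ := bil_expand hW hg hge hA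
  have key := fun (t : ℝ) (ht : -1 < t) =>
    perturb_ineq hW hmax hf hg hA ht rfl rfl rfl rfl rfl (hcf t) (hcg t)
  generalize graphonMu W = mu at *
  generalize graphonNu W = nu at *
  generalize (∫ x in A, f x ^ 2 ∂unitInt) = p at *
  generalize (∫ x in A, g x ^ 2 ∂unitInt) = q at *
  generalize unitInt.real A = a at *
  have := linear_coeff_zero (b := (mu - nu) * a - (mu * p - nu * q))
    (c := (mu - nu) * (a * p + a * q + p * q) - (2 * mu * p * q + cf - 2 * nu * p * q - cg))
    (d := (mu - nu) * a * p * q - (cf * q - cg * p)) (by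
      intro t ht _
      have := key t ht
      nlinarith [this])
  linarith
end

section
/- Suppose W is a graphon such that spr(W) ≥ spr(U) for every graphon U. Then there exists a partition of [0,1] into seven Lebesgue-measurable sets I₁, …, I₇ such that for all i, j ∈ {1,…,7} and a.e. (x,y) ∈ I_i × I_j, W(x,y) = M_{ij}, where M is the symmetric 7×7 matrix with entries in {0,1} defined by M_{ij} = 1 if and only if j ∈ N_i, with N₁ = {1,2,3,4,5,6,7}, N₂ = {1,2,3,5,6,7}, N₃ = {1,2,5,6,7}, N₄ = {1,5,6,7}, N₅ = {1,2,3,4,5,6}, N₆ = {1,2,3,4,5}, N₇ = {1,2,3,4}. -/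
open MeasureTheory

/-- The 7×7 block pattern of the extremal stepgraphon: `M i j = 1` iff `j ∈ Nᵢ`, with
`N₁ = {1,…,7}`, `N₂ = {1,2,3,5,6,7}`, `N₃ = {1,2,5,6,7}`, `N₄ = {1,5,6,7}`,
`N₅ = {1,2,3,4,5,6}`, `N₆ = {1,2,3,4,5}`, `N₇ = {1,2,3,4}`. -/
def stepMatrix : Fin 7 → Fin 7 → ℝ :=
  ![![1, 1, 1, 1, 1, 1, 1],
    ![1, 1, 1, 0, 1, 1, 1],
    ![1, 1, 0, 0, 1, 1, 1],
    ![1, 0, 0, 0, 1, 1, 1],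
    ![1, 1, 1, 1, 1, 1, 0],
    ![1, 1, 1, 1, 1, 0, 0],
    ![1, 1, 1, 1, 0, 0, 0]]

namespace GS

instance : IsProbabilityMeasure unitInt := by
  unfold unitInt
  constructor
  simp

instance : NullSingletonClass unitInt := by unfold unitInt; infer_instance

lemma unitSq_eq : unitSq = unitInt.prod unitInt := by
  unfold unitSq unitInt
  rw [Measure.prod_restrict]; rfl

/-- bounded symmetric kernels -/
def Ker (k : ℝ → ℝ → ℝ) : Prop :=
  Measurable (Function.uncurry k) ∧ (∀ x y, |k x y| ≤ 1) ∧
    (∀ᵐ p : ℝ × ℝ ∂(unitInt.prod unitInt), k p.1 p.2 = k p.2 p.1)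

def L2 (f : ℝ → ℝ) : Prop := Measurable f ∧ Integrable (fun x => f x ^ 2) unitInt

noncomputable def EE (k : ℝ → ℝ → ℝ) (φ ψ : ℝ → ℝ) : ℝ :=
  ∫ p, k p.1 p.2 * (φ p.1 * ψ p.2) ∂(unitInt.prod unitInt)

noncomputable def op (k : ℝ → ℝ → ℝ) (f : ℝ → ℝ) (x : ℝ) : ℝ := ∫ y, k x y * f y ∂unitInt

noncomputable def nn (f : ℝ → ℝ) : ℝ := ∫ x, f x ^ 2 ∂unitInt

lemma L2.mul {f g : ℝ → ℝ} (hf : L2 f) (hg : L2 g) : Integrable (fun x => f x * g x) unitInt := by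
  refine Integrable.mono' (hf.2.add hg.2) (hf.1.mul hg.1).aestronglyMeasurable ?_
  filter_upwards with x
  rw [Real.norm_eq_abs, abs_mul]
  simp only [Pi.add_apply]
  nlinarith [sq_nonneg (|f x| - |g x|), sq_abs (f x), sq_abs (g x), sq_nonneg (f x), sq_nonneg (g x)]

lemma L2.const (c : ℝ) : L2 (fun _ => c) := ⟨measurable_const, integrable_const _⟩

lemma L2.int {f : ℝ → ℝ} (hf : L2 f) : Integrable f unitInt := by
  simpa using hf.mul (L2.const 1)

lemma L2.add {f g : ℝ → ℝ} (hf : L2 f) (hg : L2 g) : L2 (fun x => f x + g x) := by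
  refine ⟨hf.1.add hg.1, ?_⟩
  have := (hf.2.add ((hf.mul hg).const_mul 2)).add hg.2
  refine this.congr ?_
  filter_upwards with x
  simp only [Pi.add_apply]; ring

lemma L2.smul {f : ℝ → ℝ} (c : ℝ) (hf : L2 f) : L2 (fun x => c * f x) := by
  refine ⟨hf.1.const_mul c, ?_⟩
  have := hf.2.const_mul (c^2)
  refine this.congr ?_
  filter_upwards with x
  ring

lemma L2.of_bdd {f : ℝ → ℝ} (hf : Measurable f) (C : ℝ) (hC : ∀ x, |f x| ≤ C) : L2 f := by
  refine ⟨hf, ?_⟩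
  refine Integrable.of_bound (hf.pow_const 2).aestronglyMeasurable (C^2) ?_
  filter_upwards with x
  rw [Real.norm_eq_abs, abs_pow]
  gcongr
  exact hC x

lemma nn_nonneg (f : ℝ → ℝ) : 0 ≤ nn f := integral_nonneg (fun _ => sq_nonneg _)

lemma nn_smul (c : ℝ) (f : ℝ → ℝ) : nn (fun x => c * f x) = c^2 * nn f := by
  unfold nn
  rw [← integral_const_mul]; congr 1; ext x; ring

lemma nn_add {f g : ℝ → ℝ} (hf : L2 f) (hg : L2 g) :
    nn (fun x => f x + g x) = nn f + 2 * ∫ x, f x * g x ∂unitInt + nn g := by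
  unfold nn
  rw [← integral_const_mul, ← integral_add hf.2 ((hf.mul hg).const_mul 2), ← integral_add _ hg.2]
  · congr 1; ext x; ring
  · exact hf.2.add ((hf.mul hg).const_mul 2)

lemma isUnit_iff {f : ℝ → ℝ} : IsUnitL2 f ↔ L2 f ∧ nn f = 1 := by
  constructor
  · rintro ⟨h1, h2⟩
    refine ⟨⟨h1, ?_⟩, h2⟩
    by_contra h
    have : (∫ x in Set.Icc (0 : ℝ) 1, (f x) ^ 2) = 0 := integral_undef h
    rw [this] at h2
    norm_num at h2
  · rintro ⟨h1, h2⟩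
    exact ⟨h1.1, h2⟩

lemma EE_int {k : ℝ → ℝ → ℝ} (hk : Ker k) {φ ψ : ℝ → ℝ} (hφ : Integrable φ unitInt)
    (hψ : Integrable ψ unitInt) :
    Integrable (fun p : ℝ × ℝ => k p.1 p.2 * (φ p.1 * ψ p.2)) (unitInt.prod unitInt) := by
  refine (hφ.mul_prod hψ).bdd_mul (c := 1) ?_ ?_
  · exact hk.1.aestronglyMeasurable
  · filter_upwards with p using hk.2.1 _ _

lemma EE_eq_op {k : ℝ → ℝ → ℝ} (hk : Ker k) {φ ψ : ℝ → ℝ} (hφ : Integrable φ unitInt)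
    (hψ : Integrable ψ unitInt) : EE k φ ψ = ∫ x, φ x * op k ψ x ∂unitInt := by
  unfold EE op
  rw [integral_prod _ (EE_int hk hφ hψ)]
  congr 1; ext x
  rw [← integral_const_mul]
  congr 1; ext y; ring

lemma quadForm_eq {k : ℝ → ℝ → ℝ} (hk : Ker k) {φ : ℝ → ℝ} (hφ : Integrable φ unitInt) :
    quadForm k φ = EE k φ φ := by
  unfold EE quadForm
  rw [integral_prod _ (EE_int hk hφ hφ)]
  change ∫ x, ∫ y, _ ∂unitInt ∂unitInt = _
  congr 1; ext x; congr 1; ext y; ring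

lemma op_meas {k : ℝ → ℝ → ℝ} (hk : Ker k) {f : ℝ → ℝ} (hf : Measurable f) :
    Measurable (op k f) := by
  have : StronglyMeasurable (fun p : ℝ × ℝ => k p.1 p.2 * f p.2) :=
    (hk.1.mul (hf.comp measurable_snd)).stronglyMeasurable
  exact (this.integral_prod_right' (ν := unitInt)).measurable

lemma op_bound {k : ℝ → ℝ → ℝ} (hk : Ker k) {f : ℝ → ℝ} (hf : Integrable f unitInt) (x : ℝ) :
    |op k f x| ≤ ∫ y, |f y| ∂unitInt := by
  unfold op
  refine le_trans (norm_integral_le_integral_norm (fun y => k x y * f y)) ?_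
  refine integral_mono_of_nonneg (by filter_upwards with y using norm_nonneg _) hf.abs ?_
  filter_upwards with y
  rw [norm_mul, Real.norm_eq_abs, Real.norm_eq_abs]
  exact mul_le_of_le_one_left (abs_nonneg _) (hk.2.1 x y)

lemma op_L2 {k : ℝ → ℝ → ℝ} (hk : Ker k) {f : ℝ → ℝ} (hf : L2 f) : L2 (op k f) :=
  L2.of_bdd (op_meas hk hf.1) _ (op_bound hk hf.int)

lemma EE_symm {k : ℝ → ℝ → ℝ} (hk : Ker k) (φ ψ : ℝ → ℝ) : EE k φ ψ = EE k ψ φ := by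
  unfold EE
  rw [← integral_prod_swap]
  refine integral_congr_ae ?_
  filter_upwards [hk.2.2] with p hp
  simp only [Prod.fst_swap, Prod.snd_swap]
  rw [hp]; ring

lemma EE_add {k : ℝ → ℝ → ℝ} (hk : Ker k) {φ ψ : ℝ → ℝ} (hφ : Integrable φ unitInt)
    (hψ : Integrable ψ unitInt) :
    EE k (fun x => φ x + ψ x) (fun x => φ x + ψ x) = EE k φ φ + 2 * EE k φ ψ + EE k ψ ψ := by
  have h1 : EE k (fun x => φ x + ψ x) (fun x => φ x + ψ x)
      = EE k φ φ + EE k φ ψ + EE k ψ φ + EE k ψ ψ := by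
    unfold EE
    rw [← integral_add (EE_int hk hφ hφ) (EE_int hk hφ hψ),
      ← integral_add _ (EE_int hk hψ hφ), ← integral_add _ (EE_int hk hψ hψ)]
    · congr 1; ext p; ring
    · exact ((EE_int hk hφ hφ).add (EE_int hk hφ hψ)).add (EE_int hk hψ hφ)
    · exact ((EE_int hk hφ hφ).add (EE_int hk hφ hψ))
  rw [h1, EE_symm hk ψ φ]; ring

lemma EE_smul (k : ℝ → ℝ → ℝ) (c d : ℝ) (φ ψ : ℝ → ℝ) :
    EE k (fun x => c * φ x) (fun x => d * ψ x) = c * d * EE k φ ψ := by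
  unfold EE
  rw [← integral_const_mul]
  congr 1; ext p; ring

lemma EE_neg (k : ℝ → ℝ → ℝ) (φ ψ : ℝ → ℝ) :
    EE (fun x y => - k x y) φ ψ = - EE k φ ψ := by
  unfold EE
  rw [← integral_neg]
  congr 1; ext p; ring

lemma EE_congr (k : ℝ → ℝ → ℝ) {φ φ' : ℝ → ℝ} (h : φ =ᵐ[unitInt] φ') :
    EE k φ φ = EE k φ' φ' := by
  unfold EE
  refine integral_congr_ae ?_
  filter_upwards [Measure.quasiMeasurePreserving_fst.ae h, Measure.quasiMeasurePreserving_snd.ae h]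
    with p h1 h2
  rw [h1, h2]

lemma nn_congr {φ φ' : ℝ → ℝ} (h : φ =ᵐ[unitInt] φ') : nn φ = nn φ' := by
  unfold nn
  refine integral_congr_ae ?_
  filter_upwards [h] with p h1
  rw [h1]

lemma sq_int_abs_le {φ : ℝ → ℝ} (hφ : L2 φ) : (∫ x, |φ x| ∂unitInt)^2 ≤ nn φ := by
  set m := ∫ x, |φ x| ∂unitInt
  have h0 : L2 (fun x => |φ x|) := ⟨hφ.1.abs, by simpa using hφ.2⟩
  have h1 := nn_nonneg (fun x => |φ x| + (-m))
  rw [nn_add h0 (L2.const _), integral_mul_const] at h1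
  have h2 : nn (fun _ => -m) = m^2 := by unfold nn; simp
  have h3 : nn (fun x => |φ x|) = nn φ := by unfold nn; simp
  rw [h2, h3] at h1
  change 0 ≤ nn φ + 2 * (m * -m) + m^2 at h1
  nlinarith

lemma EE_abs_le {k : ℝ → ℝ → ℝ} (hk : Ker k) {φ : ℝ → ℝ} (hφ : L2 φ) : |EE k φ φ| ≤ nn φ := by
  refine le_trans ?_ (sq_int_abs_le hφ)
  unfold EE
  refine le_trans (norm_integral_le_integral_norm (fun p : ℝ × ℝ => k p.1 p.2 * (φ p.1 * φ p.2))) ?_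
  have : (∫ x, |φ x| ∂unitInt)^2 = ∫ p, |φ p.1| * |φ p.2| ∂(unitInt.prod unitInt) := by
    rw [integral_prod_mul (fun x => |φ x|) (fun x => |φ x|), sq]
  rw [this]
  refine integral_mono_of_nonneg (by filter_upwards with y using norm_nonneg _)
    (hφ.int.abs.mul_prod hφ.int.abs) ?_
  filter_upwards with p
  rw [norm_mul, norm_mul, Real.norm_eq_abs, Real.norm_eq_abs, Real.norm_eq_abs]
  exact mul_le_of_le_one_left (by positivity) (hk.2.1 _ _)

lemma Ker.neg {k : ℝ → ℝ → ℝ} (hk : Ker k) : Ker (fun x y => - k x y) := by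
  refine ⟨hk.1.neg, fun x y => by rw [abs_neg]; exact hk.2.1 x y, ?_⟩
  filter_upwards [hk.2.2] with p hp
  rw [hp]

lemma _root_.IsGraphon.ker {W : ℝ → ℝ → ℝ} (hW : IsGraphon W) : Ker W := by
  refine ⟨hW.1, fun x y => ?_, by rw [← unitSq_eq]; exact hW.2.2⟩
  have := hW.2.1 x y
  rw [abs_of_nonneg this.1]; exact this.2

/-- homogeneous bound -/
lemma hom_bound {k : ℝ → ℝ → ℝ} (hk : Ker k) {m : ℝ}
    (hm : ∀ φ, L2 φ → nn φ = 1 → EE k φ φ ≤ m) {φ : ℝ → ℝ} (hφ : L2 φ) :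
    EE k φ φ ≤ m * nn φ := by
  rcases (nn_nonneg φ).eq_or_lt with h | h
  · have := EE_abs_le hk hφ
    rw [← h] at this ⊢
    linarith [abs_le.mp this]
  · have h1 := hm (fun x => (Real.sqrt (nn φ))⁻¹ * φ x) (hφ.smul _) (by
      rw [nn_smul, inv_pow, Real.sq_sqrt h.le, inv_mul_cancel₀ h.ne'])
    rw [EE_smul, ← sq, inv_pow, Real.sq_sqrt h.le, inv_mul_le_iff₀ h] at h1
    linarith

/-- a maximiser of the form is an eigenfunction -/
lemma eig_of_max {k : ℝ → ℝ → ℝ} (hk : Ker k) {m : ℝ}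
    (hm : ∀ φ, L2 φ → nn φ = 1 → EE k φ φ ≤ m) {f : ℝ → ℝ} (hf : L2 f) (hf1 : nn f = 1)
    (he : EE k f f = m) : ∀ᵐ x ∂unitInt, op k f x = m * f x := by
  set h : ℝ → ℝ := fun x => op k f x + (-m) * f x with hh
  have hL : L2 h := (op_L2 hk hf).add (hf.smul _)
  have key : ∀ ε : ℝ, 2 * ε * nn h + ε^2 * (EE k h h - m * nn h) ≤ 0 := by
    intro ε
    have h1 := hom_bound hk hm (hf.add (hL.smul ε))
    rw [EE_add hk hf.int (hL.smul ε).int, nn_add hf (hL.smul ε), nn_smul,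
      EE_smul, EE_symm hk f (fun x => ε * h x)] at h1
    have h2 : EE k (fun x => ε * h x) f = ε * EE k h f := by
      have := EE_smul k ε 1 h f
      simpa using this
    have h3 : ∫ x, f x * (ε * h x) ∂unitInt = ε * ∫ x, h x * f x ∂unitInt := by
      rw [← integral_const_mul]; congr 1; ext x; ring
    have h4 : EE k h f = nn h + m * ∫ x, h x * f x ∂unitInt := by
      rw [EE_eq_op hk hL.int hf.int]
      unfold nn
      rw [← integral_const_mul, ← integral_add hL.2 ((hL.mul hf).const_mul m)]
      congr 1; ext x; simp only [hh]; ring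
    rw [h2, h3, h4, he, hf1] at h1
    nlinarith
  have h0 : nn h = 0 := by
    refine le_antisymm ?_ (nn_nonneg h)
    by_contra hpos
    push Not at hpos
    set D := EE k h h - m * nn h
    have hD : 0 < |D| + 1 := by positivity
    have := key (nn h / (|D| + 1))
    have e : 2 * (nn h / (|D| + 1)) * nn h + (nn h / (|D| + 1))^2 * D
       = (nn h)^2 / (|D| + 1)^2 * (2 * (|D| + 1) + D) := by field_simp
    rw [e] at this
    have h5 : 0 < 2 * (|D| + 1) + D := by linarith [neg_abs_le D, abs_nonneg D]
    have : 0 < (nn h)^2 / (|D| + 1)^2 * (2 * (|D| + 1) + D) := by positivity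
    linarith
  have := (integral_eq_zero_iff_of_nonneg (fun x => sq_nonneg (h x)) hL.2).1 h0
  filter_upwards [this] with x hx
  have : h x = 0 := by simpa using hx
  simp only [hh] at this
  linarith

end GS

namespace GS
open Filter Topology

lemma weak_cpt (φ : ℕ → ℝ → ℝ) (h : ∀ n, L2 (φ n) ∧ nn (φ n) = 1) :
    ∃ f, L2 f ∧ ∃ σ : ℕ → ℕ, StrictMono σ ∧ ∀ ψ, L2 ψ →
      Tendsto (fun n => ∫ x, φ (σ n) x * ψ x ∂unitInt) atTop (𝓝 (∫ x, f x * ψ x ∂unitInt)) := by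
  have hmem : ∀ ψ, L2 ψ → MemLp ψ 2 unitInt := fun ψ hψ =>
    (memLp_two_iff_integrable_sq hψ.1.aestronglyMeasurable).2 hψ.2
  have hinner : ∀ u v : Lp ℝ 2 unitInt, inner ℝ u v = ∫ x, u x * v x ∂unitInt := by
    intro u v
    rw [L2.inner_def]
    congr 1; ext x
    simp [mul_comm]
  let u : ℕ → Lp ℝ 2 unitInt := fun n => (hmem (φ n) (h n).1).toLp
  have hu : ∀ n, ‖u n‖ = 1 := by
    intro n
    have h1 : ‖u n‖^2 = 1 := by
      rw [← real_inner_self_eq_norm_sq, hinner, ← (h n).2]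
      refine integral_congr_ae ?_
      filter_upwards [(hmem (φ n) (h n).1).coeFn_toLp] with x hx
      rw [hx]; ring
    have := norm_nonneg (u n)
    nlinarith
  have : Fact ((2 : ENNReal) ≠ ⊤) := ⟨by norm_num⟩
  have : TopologicalSpace.SeparableSpace (Lp ℝ 2 unitInt) := inferInstance
  have hc := WeakDual.isSeqCompact_closedBall ℝ (Lp ℝ 2 unitInt) 0 1
  let a : ℕ → WeakDual ℝ (Lp ℝ 2 unitInt) := fun n =>
    StrongDual.toWeakDual (InnerProductSpace.toDual ℝ _ (u n))
  obtain ⟨b, -, σ, hσ, hlim⟩ := hc (x := a) (fun n => by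
    simp only [Set.mem_preimage, Metric.mem_closedBall, dist_zero_right, a]
    change ‖InnerProductSpace.toDual ℝ _ (u n)‖ ≤ 1
    rw [LinearIsometryEquiv.norm_map, hu])
  let f0 : Lp ℝ 2 unitInt := (InnerProductSpace.toDual ℝ _).symm (WeakDual.toStrongDual b)
  have hf0 : L2 (f0 : ℝ → ℝ) := ⟨(Lp.stronglyMeasurable f0).measurable,
    (memLp_two_iff_integrable_sq (Lp.aestronglyMeasurable f0)).1 (Lp.memLp f0)⟩
  refine ⟨f0, hf0, σ, hσ, fun ψ hψ => ?_⟩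
  have h1 := ((WeakDual.eval_continuous ((hmem ψ hψ).toLp)).tendsto b).comp hlim
  have h2 : b ((hmem ψ hψ).toLp) = ∫ x, f0 x * ψ x ∂unitInt := by
    have : b ((hmem ψ hψ).toLp) = inner ℝ f0 ((hmem ψ hψ).toLp) := by
      rw [InnerProductSpace.toDual_symm_apply]; rfl
    rw [this, hinner]
    refine integral_congr_ae ?_
    filter_upwards [(hmem ψ hψ).coeFn_toLp] with x hx
    rw [hx]
  rw [h2] at h1
  refine h1.congr fun n => ?_
  have : a (σ n) ((hmem ψ hψ).toLp) = inner ℝ (u (σ n)) ((hmem ψ hψ).toLp) := rfl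
  change a (σ n) ((hmem ψ hψ).toLp) = _
  rw [this, hinner]
  refine integral_congr_ae ?_
  filter_upwards [(hmem ψ hψ).coeFn_toLp, (hmem (φ (σ n)) (h (σ n)).1).coeFn_toLp] with x hx hx2
  rw [hx, hx2]

lemma cs1 {a d : ℝ → ℝ} (ha : L2 a) (ha1 : nn a = 1) (hd : L2 d) :
    (∫ x, a x * d x ∂unitInt)^2 ≤ nn d := by
  set c := ∫ x, a x * d x ∂unitInt with hc
  have h := nn_nonneg (fun x => d x + (-c) * a x)
  rw [nn_add hd (ha.smul _), nn_smul, ha1] at h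
  have : ∫ x, d x * (-c * a x) ∂unitInt = -c * c := by
    rw [hc, ← integral_const_mul]; congr 1; ext x; ring
  rw [this] at h
  nlinarith

lemma attain {k : ℝ → ℝ → ℝ} (hk : Ker k) {m : ℝ} (hm0 : 0 < m)
    (hm : ∀ φ, L2 φ → nn φ = 1 → EE k φ φ ≤ m)
    (hs : ∀ ε > 0, ∃ φ, L2 φ ∧ nn φ = 1 ∧ m - ε < EE k φ φ) :
    ∃ f, L2 f ∧ nn f = 1 ∧ EE k f f = m := by
  have hs' : ∀ n : ℕ, ∃ φ, L2 φ ∧ nn φ = 1 ∧ m - 1 / ((n : ℝ) + 1) < EE k φ φ := fun n =>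
    hs _ (by positivity)
  choose φ0 h1 h2 h3 using hs'
  obtain ⟨f, hf, σ, hσ, hw⟩ := weak_cpt φ0 (fun n => ⟨h1 n, h2 n⟩)
  set φ : ℕ → ℝ → ℝ := fun n => φ0 (σ n) with hφ
  have hφL : ∀ n, L2 (φ n) := fun n => h1 _
  have hφ1 : ∀ n, nn (φ n) = 1 := fun n => h2 _
  have hf1 : nn f ≤ 1 := by
    have e : ∀ n, 0 ≤ 1 - 2 * (∫ x, φ n x * f x ∂unitInt) + nn f := by
      intro n
      have h := nn_nonneg (fun x => φ n x + (-1) * f x)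
      rw [nn_add (hφL n) (hf.smul _), nn_smul, hφ1] at h
      have : ∫ x, φ n x * (-1 * f x) ∂unitInt = - ∫ x, φ n x * f x ∂unitInt := by
        rw [← integral_neg]; congr 1; ext x; ring
      rw [this] at h
      linarith
    have l : Tendsto (fun n => 1 - 2 * (∫ x, φ n x * f x ∂unitInt) + nn f) atTop
        (𝓝 (1 - 2 * (∫ x, f x * f x ∂unitInt) + nn f)) :=
      ((tendsto_const_nhds.sub ((hw f hf).const_mul 2)).add tendsto_const_nhds)
    have := ge_of_tendsto' l e
    have e2 : ∫ x, f x * f x ∂unitInt = nn f := by unfold nn; congr 1; ext x; ring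
    rw [e2] at this
    linarith
  have hop : ∀ x, Tendsto (fun n => op k (φ n) x) atTop (𝓝 (op k f x)) := by
    intro x
    have hk1 : L2 (fun y => k x y) :=
      L2.of_bdd (hk.1.comp measurable_prodMk_left) 1 (hk.2.1 x)
    have := hw _ hk1
    unfold op
    simpa only [mul_comm] using this
  have hbd : ∀ n x, |op k (φ n) x| ≤ 1 := by
    intro n x
    refine (op_bound hk (hφL n).int x).trans ?_
    have := sq_int_abs_le (hφL n)
    rw [hφ1] at this
    have h0 : 0 ≤ ∫ x, |φ n x| ∂unitInt := integral_nonneg fun x => abs_nonneg _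
    nlinarith
  have hbd' : ∀ x, |op k f x| ≤ 1 := fun x =>
    le_of_tendsto' (hop x).abs (fun n => hbd n x)
  set d : ℕ → ℝ → ℝ := fun n x => op k (φ n) x + (-1) * op k f x with hd
  have hdL : ∀ n, L2 (d n) := fun n => (op_L2 hk (hφL n)).add ((op_L2 hk hf).smul _)
  have hnd : Tendsto (fun n => nn (d n)) atTop (𝓝 0) := by
    have : (0 : ℝ) = ∫ x, (0 : ℝ) ∂unitInt := by simp
    rw [this]
    unfold nn
    refine tendsto_integral_of_dominated_convergence (fun _ => 4) ?_ (integrable_const _) ?_ ?_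
    · intro n; exact (hdL n).2.1
    · intro n
      filter_upwards with x
      rw [Real.norm_eq_abs, abs_of_nonneg (sq_nonneg _)]
      have a1 := abs_le.1 (hbd n x)
      have a2 := abs_le.1 (hbd' x)
      simp only [hd]
      nlinarith
    · filter_upwards with x
      have := ((hop x).add ((tendsto_const_nhds (x := op k f x)).const_mul (-1))).pow 2
      simpa [hd] using this
  have hz : Tendsto (fun n => ∫ x, φ n x * d n x ∂unitInt) atTop (𝓝 0) := by
    refine squeeze_zero_norm (a := fun n => Real.sqrt (nn (d n))) ?_ ?_
    · intro n
      exact Real.abs_le_sqrt (cs1 (hφL n) (hφ1 n) (hdL n))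
    · simpa using hnd.sqrt
  have hE : Tendsto (fun n => EE k (φ n) (φ n)) atTop (𝓝 (EE k f f)) := by
    have l := (hw _ (op_L2 hk hf)).add hz
    rw [EE_eq_op hk hf.int hf.int]
    rw [add_zero] at l
    refine l.congr fun n => ?_
    rw [EE_eq_op hk (hφL n).int (hφL n).int, ← integral_add ((hφL n).mul (op_L2 hk hf))
      ((hφL n).mul (hdL n))]
    congr 1; ext x; simp only [hd]; ring
  have hEm : Tendsto (fun n => EE k (φ n) (φ n)) atTop (𝓝 m) := by
    refine tendsto_of_tendsto_of_tendsto_of_le_of_le (g := fun n => m - 1 / (((σ n : ℕ) : ℝ) + 1))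
      (h := fun _ => m) ?_ tendsto_const_nhds (fun n => (h3 (σ n)).le)
      (fun n => hm _ (hφL n) (hφ1 n))
    have := (tendsto_const_nhds (x := m)).sub
      ((tendsto_one_div_add_atTop_nhds_zero_nat (𝕜 := ℝ)).comp hσ.tendsto_atTop)
    simpa [hd] using this
  have hfm : EE k f f = m := tendsto_nhds_unique hE hEm
  refine ⟨f, hf, ?_, hfm⟩
  have := hom_bound hk hm hf
  rw [hfm] at this
  have : 1 ≤ nn f := by
    by_contra hcon
    push Not at hcon
    nlinarith
  linarith

end GS

namespace GS
open Filter Topology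

def Bd (S : ℝ) : Prop := ∀ U, IsGraphon U → ∀ φ ψ, L2 φ → nn φ = 1 → L2 ψ → nn ψ = 1 →
  EE U φ φ - EE U ψ ψ ≤ S

structure Opt (S : ℝ) (W : ℝ → ℝ → ℝ) (f g : ℝ → ℝ) : Prop where
  gr : IsGraphon W
  fL : L2 f
  f1 : nn f = 1
  gL : L2 g
  g1 : nn g = 1
  eq : EE W f f - EE W g g = S

lemma example_spr : ∃ U, IsGraphon U ∧ ∃ φ ψ, L2 φ ∧ nn φ = 1 ∧ L2 ψ ∧ nn ψ = 1 ∧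
    1 < EE U φ φ - EE U ψ ψ := by
  classical
  set h : ℝ → ℝ := Set.indicator (Set.Ioi (1/2 : ℝ)) (fun _ => 1) with hh
  have hm : Measurable h := measurable_const.indicator measurableSet_Ioi
  have h01 : ∀ x, h x = 0 ∨ h x = 1 := by
    intro x
    by_cases hx : x ∈ Set.Ioi (1/2 : ℝ)
    · right; simp only [hh, Set.indicator_of_mem hx]
    · left; simp only [hh, Set.indicator_of_notMem hx]
  have hi : ∫ x, h x ∂unitInt = 1/2 := by
    rw [hh, integral_indicator_const _ measurableSet_Ioi]
    unfold unitInt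
    rw [measureReal_restrict_apply measurableSet_Ioi]
    have : Set.Ioi (1/2 : ℝ) ∩ Set.Icc 0 1 = Set.Ioc (1/2) 1 := by
      ext x
      simp only [Set.mem_inter_iff, Set.mem_Ioi, Set.mem_Icc, Set.mem_Ioc]
      constructor
      · rintro ⟨a, b, c⟩; exact ⟨a, c⟩
      · rintro ⟨a, b⟩; exact ⟨a, by linarith, b⟩
    rw [this]
    simp [Measure.real]
    norm_num
  have hL : L2 h := L2.of_bdd hm 1 (fun x => by rcases h01 x with e | e <;> rw [e] <;> norm_num)
  set U : ℝ → ℝ → ℝ := fun x y => 1 - h x * h y with hU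
  have hG : IsGraphon U := by
    refine ⟨?_, ?_, ?_⟩
    · exact measurable_const.sub ((hm.comp measurable_fst).mul (hm.comp measurable_snd))
    · intro x y
      simp only [hU]
      rcases h01 x with e | e <;> rcases h01 y with e' | e' <;> rw [e, e'] <;> norm_num
    · filter_upwards with p
      simp only [hU]; ring
  have hE : ∀ φ, L2 φ → EE U φ φ = (∫ x, φ x ∂unitInt)^2 - (∫ x, h x * φ x ∂unitInt)^2 := by
    intro φ hφ
    have e1 := integral_prod_mul (μ := unitInt) (ν := unitInt) φ φ
    have e2 := integral_prod_mul (μ := unitInt) (ν := unitInt) (fun x => h x * φ x)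
      (fun x => h x * φ x)
    rw [sq, sq, ← e1, ← e2, ← integral_sub (hφ.int.mul_prod hφ.int)
      ((hL.mul hφ).mul_prod (hL.mul hφ))]
    unfold EE
    congr 1; ext p; simp only [hU]; ring
  refine ⟨U, hG, fun _ => 1, fun x => Real.sqrt (2/5) * (1 + (-3) * h x), L2.const 1, ?_, ?_, ?_, ?_⟩
  · simp [nn]
  · exact ((L2.const 1).add (hL.smul _)).smul _
  · rw [nn_smul]
    have : nn (fun x => 1 + (-3) * h x) = 5/2 := by
      have : nn (fun x => 1 + (-3) * h x) = ∫ x, 1 + 3 * h x ∂unitInt := by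
        unfold nn
        congr 1; ext x
        rcases h01 x with e | e <;> simp only [e] <;> norm_num
      rw [this, integral_add (integrable_const _) (hL.int.const_mul _), integral_const_mul, hi]
      simp; norm_num
    rw [this, Real.sq_sqrt (by norm_num)]; norm_num
  · have e1 : EE U (fun _ => 1) (fun _ => 1) = 3/4 := by
      rw [hE _ (L2.const 1)]
      simp only [mul_one, hi]; simp; norm_num
    have e2 : EE U (fun x => 1 + (-3) * h x) (fun x => 1 + (-3) * h x) = -3/4 := by
      rw [hE _ ((L2.const 1).add (hL.smul _)),
        integral_add (integrable_const _) (hL.int.const_mul _), integral_const_mul, hi]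
      have : ∫ x, h x * (1 + (-3) * h x) ∂unitInt = ∫ x, (-2) * h x ∂unitInt := by
        congr 1; ext x
        rcases h01 x with e | e <;> rw [e] <;> norm_num
      rw [this, integral_const_mul, hi]
      simp; norm_num
    rw [EE_smul, e1, e2, Real.mul_self_sqrt (by norm_num)]
    norm_num

lemma EE_abs {W : ℝ → ℝ → ℝ} (hW : IsGraphon W) (φ : ℝ → ℝ) (hφ : L2 φ) :
    |EE W φ φ| ≤ EE W (fun x => |φ x|) (fun x => |φ x|) := by
  unfold EE
  refine le_trans (norm_integral_le_integral_norm
    (fun p : ℝ × ℝ => W p.1 p.2 * (φ p.1 * φ p.2))) (le_of_eq ?_)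
  congr 1; ext p
  rw [norm_mul, norm_mul, Real.norm_eq_abs, Real.norm_eq_abs, Real.norm_eq_abs,
    abs_of_nonneg (hW.2.1 _ _).1]

lemma L2.abs {φ : ℝ → ℝ} (hφ : L2 φ) : L2 (fun x => |φ x|) := ⟨hφ.1.abs, by simpa using hφ.2⟩

lemma nn_abs (φ : ℝ → ℝ) : nn (fun x => |φ x|) = nn φ := by unfold nn; simp

lemma spr_set (U : ℝ → ℝ → ℝ) (hU : IsGraphon U) :
    {r : ℝ | ∃ f : ℝ → ℝ, IsUnitL2 f ∧ r = quadForm U f}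
      = {r : ℝ | ∃ f : ℝ → ℝ, (L2 f ∧ nn f = 1) ∧ r = EE U f f} := by
  ext r
  constructor
  · rintro ⟨f, hf, e⟩
    rw [isUnit_iff] at hf
    exact ⟨f, hf, by rw [e, quadForm_eq hU.ker hf.1.int]⟩
  · rintro ⟨f, hf, e⟩
    exact ⟨f, isUnit_iff.2 hf, by rw [e, quadForm_eq hU.ker hf.1.int]⟩

lemma exists_opt {W : ℝ → ℝ → ℝ} (hW : IsGraphon W)
    (hmax : ∀ U : ℝ → ℝ → ℝ, IsGraphon U → graphonSpr U ≤ graphonSpr W) :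
    ∃ S f g, 1 < S ∧ Bd S ∧ Opt S W f g := by
  have one1 : nn (fun _ : ℝ => (1:ℝ)) = 1 := by simp [nn]
  have ba : ∀ U, IsGraphon U → BddAbove {r : ℝ | ∃ f : ℝ → ℝ, (L2 f ∧ nn f = 1) ∧ r = EE U f f} := by
    intro U hU
    refine ⟨1, ?_⟩
    rintro r ⟨f, hf, rfl⟩
    have := abs_le.1 (EE_abs_le hU.ker hf.1)
    linarith [hf.2]
  have bb : ∀ U, IsGraphon U → BddBelow {r : ℝ | ∃ f : ℝ → ℝ, (L2 f ∧ nn f = 1) ∧ r = EE U f f} := by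
    intro U hU
    refine ⟨-1, ?_⟩
    rintro r ⟨f, hf, rfl⟩
    have := abs_le.1 (EE_abs_le hU.ker hf.1)
    linarith [hf.2]
  have ne : ∀ U : ℝ → ℝ → ℝ,
      {r : ℝ | ∃ f : ℝ → ℝ, (L2 f ∧ nn f = 1) ∧ r = EE U f f}.Nonempty := fun U =>
    ⟨_, _, ⟨L2.const 1, one1⟩, rfl⟩
  have up : ∀ U, IsGraphon U → ∀ φ, L2 φ → nn φ = 1 → EE U φ φ ≤ graphonMu U := by
    intro U hU φ h1 h2
    unfold graphonMu
    rw [spr_set U hU]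
    exact le_csSup (ba U hU) ⟨φ, ⟨h1, h2⟩, rfl⟩
  have dn : ∀ U, IsGraphon U → ∀ φ, L2 φ → nn φ = 1 → graphonNu U ≤ EE U φ φ := by
    intro U hU φ h1 h2
    unfold graphonNu
    rw [spr_set U hU]
    exact csInf_le (bb U hU) ⟨φ, ⟨h1, h2⟩, rfl⟩
  have hB : Bd (graphonSpr W) := by
    intro U hU φ ψ h1 h2 h3 h4
    have := hmax U hU
    have a := up U hU φ h1 h2
    have b := dn U hU ψ h3 h4
    unfold graphonSpr at *
    linarith
  have hS : 1 < graphonSpr W := by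
    obtain ⟨U, hU, φ, ψ, h1, h2, h3, h4, h5⟩ := example_spr
    linarith [hB U hU φ ψ h1 h2 h3 h4]
  have hmu1 : graphonMu W ≤ 1 := by
    unfold graphonMu
    rw [spr_set W hW]
    refine csSup_le (ne W) ?_
    rintro r ⟨f, hf, rfl⟩
    have := abs_le.1 (EE_abs_le hW.ker hf.1)
    linarith [hf.2]
  have hnu : graphonNu W < 0 := by
    unfold graphonSpr at hS; linarith
  have app1 : ∀ ε > 0, ∃ φ, L2 φ ∧ nn φ = 1 ∧ graphonMu W - ε < EE W φ φ := by
    intro ε hε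
    have : graphonMu W - ε < sSup {r : ℝ | ∃ f : ℝ → ℝ, (L2 f ∧ nn f = 1) ∧ r = EE W f f} := by
      rw [← spr_set W hW]
      change _ < graphonMu W
      linarith
    obtain ⟨r, ⟨f, hf, rfl⟩, h⟩ := exists_lt_of_lt_csSup (ne W) this
    exact ⟨f, hf.1, hf.2, h⟩
  have app2 : ∀ ε > 0, ∃ φ, L2 φ ∧ nn φ = 1 ∧ EE W φ φ < graphonNu W + ε := by
    intro ε hε
    have : sInf {r : ℝ | ∃ f : ℝ → ℝ, (L2 f ∧ nn f = 1) ∧ r = EE W f f} < graphonNu W + ε := by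
      rw [← spr_set W hW]
      change graphonNu W < _
      linarith
    obtain ⟨r, ⟨f, hf, rfl⟩, h⟩ := exists_lt_of_csInf_lt (ne W) this
    exact ⟨f, hf.1, hf.2, h⟩
  have hmu : 0 < graphonMu W := by
    obtain ⟨φ, h1, h2, h3⟩ := app2 (-graphonNu W) (by linarith)
    have := EE_abs hW φ h1
    have h4 := up W hW _ h1.abs ((nn_abs φ).trans h2)
    have : 0 < |EE W φ φ| := abs_pos.2 (by linarith)
    linarith
  obtain ⟨f, f1, f2, f3⟩ := attain hW.ker hmu (up W hW) app1
  obtain ⟨g, g1, g2, g3⟩ := attain hW.ker.neg (m := -graphonNu W) (by linarith)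
    (fun φ h1 h2 => by rw [EE_neg]; linarith [dn W hW φ h1 h2])
    (fun ε hε => by
      obtain ⟨φ, a, b, c⟩ := app2 ε hε
      exact ⟨φ, a, b, by rw [EE_neg]; linarith⟩)
  rw [EE_neg] at g3
  refine ⟨graphonSpr W, f, g, hS, hB, hW, f1, f2, g1, g2, ?_⟩
  unfold graphonSpr
  linarith

lemma Opt.eigf {S W f g} (hB : Bd S) (h : Opt S W f g) :
    ∀ᵐ x ∂unitInt, op W f x = EE W f f * f x :=
  eig_of_max h.gr.ker (fun φ a b => by linarith [hB W h.gr φ g a b h.gL h.g1, h.eq]) h.fL h.f1 rfl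

lemma op_neg (k : ℝ → ℝ → ℝ) (f : ℝ → ℝ) (x : ℝ) : op (fun x y => - k x y) f x = - op k f x := by
  unfold op
  rw [← integral_neg]; congr 1; ext y; ring

lemma Opt.eigg {S W f g} (hB : Bd S) (h : Opt S W f g) :
    ∀ᵐ x ∂unitInt, op W g x = EE W g g * g x := by
  have := eig_of_max h.gr.ker.neg (m := - EE W g g) (fun φ a b => by
    rw [EE_neg]; linarith [hB W h.gr f φ h.fL h.f1 a b, h.eq]) h.gL h.g1 (by rw [EE_neg])
  filter_upwards [this] with x hx
  rw [op_neg] at hx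
  linarith

lemma Opt.nu_neg {S W f g} (hS : 1 < S) (h : Opt S W f g) : EE W g g < 0 := by
  have := abs_le.1 (EE_abs_le h.gr.ker h.fL)
  linarith [h.eq, h.f1]

lemma Opt.mu_pos {S W f g} (hB : Bd S) (hS : 1 < S) (h : Opt S W f g) : 0 < EE W f f := by
  have h1 := EE_abs h.gr g h.gL
  have h2 := hB W h.gr _ g h.gL.abs ((nn_abs g).trans h.g1) h.gL h.g1
  have h3 := h.nu_neg hS
  rw [abs_of_neg h3] at h1
  linarith [h.eq]

lemma Opt.abs {S W f g} (hB : Bd S) (h : Opt S W f g) : Opt S W (fun x => |f x|) g := by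
  refine ⟨h.gr, h.fL.abs, (nn_abs f).trans h.f1, h.gL, h.g1, ?_⟩
  have h1 := EE_abs h.gr f h.fL
  have h2 := hB W h.gr _ g h.fL.abs ((nn_abs f).trans h.f1) h.gL h.g1
  have := le_abs_self (EE W f f)
  linarith [h.eq]

lemma Opt.neg {S W f g} (h : Opt S W f g) : Opt S W f (fun x => - g x) := by
  have e : (fun x => - g x) = fun x => (-1) * g x := by ext x; ring
  refine ⟨h.gr, h.fL, h.f1, ?_, ?_, ?_⟩
  · rw [e]; exact h.gL.smul _
  · rw [e, nn_smul, h.g1]; norm_num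
  · rw [e, EE_smul, ← h.eq]; norm_num

lemma Opt.congr {S W f g f' g'} (h : Opt S W f g) (hf : f =ᵐ[unitInt] f') (hg : g =ᵐ[unitInt] g')
    (mf : Measurable f') (mg : Measurable g') : Opt S W f' g' := by
  refine ⟨h.gr, ⟨mf, h.fL.2.congr ?_⟩, (nn_congr hf).symm.trans h.f1, ⟨mg, h.gL.2.congr ?_⟩,
    (nn_congr hg).symm.trans h.g1, ?_⟩
  · filter_upwards [hf] with x hx; rw [hx]
  · filter_upwards [hg] with x hx; rw [hx]
  · rw [← EE_congr W hf, ← EE_congr W hg]; exact h.eq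

lemma Opt.orth {S W f g} (hB : Bd S) (hS : 1 < S) (h : Opt S W f g) :
    ∫ x, f x * g x ∂unitInt = 0 := by
  have h1 := EE_eq_op h.gr.ker h.fL.int h.gL.int
  have h2 := EE_eq_op h.gr.ker h.gL.int h.fL.int
  have e1 : ∫ x, f x * op W g x ∂unitInt = EE W g g * ∫ x, f x * g x ∂unitInt := by
    rw [← integral_const_mul]
    refine integral_congr_ae ?_
    filter_upwards [h.eigg hB] with x hx
    rw [hx]; ring
  have e2 : ∫ x, g x * op W f x ∂unitInt = EE W f f * ∫ x, f x * g x ∂unitInt := by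
    rw [← integral_const_mul]
    refine integral_congr_ae ?_
    filter_upwards [h.eigf hB] with x hx
    rw [hx]; ring
  rw [EE_symm h.gr.ker, h2, e2, e1] at h1
  have : S * ∫ x, f x * g x ∂unitInt = 0 := by rw [← h.eq]; linarith
  rcases mul_eq_zero.1 this with h | h
  · linarith
  · exact h

end GS

namespace GS
open Filter Topology

lemma ae_prod_fst {P : ℝ → Prop} (h : ∀ᵐ x ∂unitInt, P x) :
    ∀ᵐ p : ℝ × ℝ ∂(unitInt.prod unitInt), P p.1 := Measure.quasiMeasurePreserving_fst.ae h

lemma ae_prod_snd {P : ℝ → Prop} (h : ∀ᵐ x ∂unitInt, P x) :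
    ∀ᵐ p : ℝ × ℝ ∂(unitInt.prod unitInt), P p.2 := Measure.quasiMeasurePreserving_snd.ae h

lemma ae_swap {P : ℝ × ℝ → Prop} (h : ∀ᵐ p ∂(unitInt.prod unitInt), P p) :
    ∀ᵐ p ∂(unitInt.prod unitInt), P p.swap :=
  (Measure.measurePreserving_swap (μ := unitInt) (ν := unitInt)).quasiMeasurePreserving.ae h

lemma Opt.pos {S W f g} (hB : Bd S) (h : Opt S W f g) (hf0 : ∀ x, 0 ≤ f x) :
    ∀ᵐ x ∂unitInt, 0 < f x := by
  classical
  by_contra hcon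
  set Z : Set ℝ := {x | f x = 0} with hZdef
  have hZ : MeasurableSet Z := h.fL.1 (measurableSet_singleton 0)
  have hfreq : ∃ᶠ x in ae unitInt, x ∈ Z := by
    intro h'
    refine hcon ?_
    filter_upwards [h'] with x hx
    exact lt_of_le_of_ne (hf0 x) (fun e => hx e.symm)
  -- W vanishes on Z × Zᶜ
  have hWm : Measurable (fun p : ℝ × ℝ => W p.1 p.2) := h.gr.1
  have hW0 : ∀ᵐ p : ℝ × ℝ ∂(unitInt.prod unitInt), p.1 ∈ Z → p.2 ∉ Z → W p.1 p.2 = 0 := by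
    have hms : MeasurableSet {p : ℝ × ℝ | p.1 ∈ Z → p.2 ∉ Z → W p.1 p.2 = 0} := by
      refine MeasurableSet.imp (measurable_fst hZ) (MeasurableSet.imp (measurable_snd hZ).compl ?_)
      exact hWm (measurableSet_singleton 0)
    rw [Measure.ae_prod_iff_ae_ae hms]
    filter_upwards [h.eigf hB] with x hx
    by_cases hxZ : x ∈ Z
    · have hx0 : f x = 0 := hxZ
      rw [hx0, mul_zero] at hx
      have hi : Integrable (fun y => W x y * f y) unitInt := by
        refine h.fL.int.bdd_mul (c := 1)
          (h.gr.1.comp measurable_prodMk_left).aestronglyMeasurable ?_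
        filter_upwards with y using h.gr.ker.2.1 x y
      have := (integral_eq_zero_iff_of_nonneg
        (fun y => mul_nonneg (h.gr.2.1 x y).1 (hf0 y)) hi).1 hx
      filter_upwards [this] with y hy _ hyZ
      rcases mul_eq_zero.1 hy with e | e
      · exact e
      · exact absurd e hyZ
    · filter_upwards with y h1
      exact absurd h1 hxZ
  have hW0' : ∀ᵐ p : ℝ × ℝ ∂(unitInt.prod unitInt), p.1 ∉ Z → p.2 ∈ Z → W p.1 p.2 = 0 := by
    filter_upwards [ae_swap hW0, h.gr.ker.2.2] with p h1 h2 h3 h4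
    rw [h2]; exact h1 h4 h3
  set U : ℝ → ℝ → ℝ := fun x y => if (x ∈ Z ↔ y ∈ Z) then W x y else 1 with hUdef
  have hUg : IsGraphon U := by
    refine ⟨?_, ?_, ?_⟩
    · refine Measurable.ite ?_ hWm measurable_const
      exact MeasurableSet.iff (measurable_fst hZ) (measurable_snd hZ)
    · intro x y
      simp only [hUdef]
      split_ifs
      · exact h.gr.2.1 x y
      · norm_num
    · filter_upwards [h.gr.2.2] with p hp
      simp only [hUdef]
      rw [hp]
      congr 1
      exact propext Iff.comm
  have hUf : EE U f f = EE W f f := by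
    unfold EE
    congr 1; ext p
    simp only [hUdef]
    split_ifs with hc
    · rfl
    · by_cases h1 : p.1 ∈ Z
      · have : f p.1 = 0 := h1
        simp [this]
      · have h2 : p.2 ∈ Z := by by_contra h2; exact hc (by tauto)
        have : f p.2 = 0 := h2
        simp [this]
  set a := ∫ x, Z.indicator g x ∂unitInt
  set b := ∫ x, Zᶜ.indicator g x ∂unitInt
  obtain ⟨τ, hτ, hτab⟩ : ∃ τ : ℝ, τ^2 = 1 ∧ τ * (a * b) ≤ 0 := by
    rcases le_total 0 (a * b) with h' | h'
    · exact ⟨-1, by norm_num, by linarith⟩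
    · exact ⟨1, by norm_num, by linarith⟩
  set g' : ℝ → ℝ := fun x => if x ∈ Z then g x else τ * g x with hg'
  have hg'm : Measurable g' := Measurable.ite hZ h.gL.1 (h.gL.1.const_mul τ)
  have hg'sq : ∀ x, g' x ^ 2 = g x ^ 2 := by
    intro x
    simp only [hg']
    split_ifs
    · rfl
    · rw [mul_pow, hτ, one_mul]
  have hg'L : L2 g' := ⟨hg'm, by simp_rw [hg'sq]; exact h.gL.2⟩
  have hg'1 : nn g' = 1 := by
    rw [← h.g1]; unfold nn; simp_rw [hg'sq]
  have hUg' : EE U g' g' = EE W g g + 2 * (τ * (a * b)) := by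
    have i1 : Integrable (Z.indicator g) unitInt := h.gL.int.indicator hZ
    have i2 : Integrable (Zᶜ.indicator g) unitInt := h.gL.int.indicator hZ.compl
    have e1 := integral_prod_mul (μ := unitInt) (ν := unitInt) (Z.indicator g) (Zᶜ.indicator g)
    have e2 := integral_prod_mul (μ := unitInt) (ν := unitInt) (Zᶜ.indicator g) (Z.indicator g)
    have e3 : 2 * (τ * (a * b)) = ∫ p : ℝ × ℝ, τ * (Z.indicator g p.1 * Zᶜ.indicator g p.2
        + Zᶜ.indicator g p.1 * Z.indicator g p.2) ∂(unitInt.prod unitInt) := by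
      rw [integral_const_mul, integral_add (i1.mul_prod i2) (i2.mul_prod i1), e1, e2]
      change 2 * (τ * (a * b)) = τ * (a * b + b * a)
      ring
    rw [e3]
    unfold EE
    have i3 : Integrable (fun p : ℝ × ℝ => τ * (Z.indicator g p.1 * Zᶜ.indicator g p.2
        + Zᶜ.indicator g p.1 * Z.indicator g p.2)) (unitInt.prod unitInt) :=
      ((i1.mul_prod i2).add (i2.mul_prod i1)).const_mul τ
    rw [← integral_add (EE_int h.gr.ker h.gL.int h.gL.int) i3]
    refine integral_congr_ae ?_
    filter_upwards [hW0, hW0'] with p h1 h2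
    by_cases c1 : p.1 ∈ Z <;> by_cases c2 : p.2 ∈ Z
    · simp [hUdef, hg', c1, c2]
    · simp [hUdef, hg', c1, c2, h1 c1 c2]; ring
    · simp [hUdef, hg', c1, c2, h2 c1 c2]; ring
    · simp [hUdef, hg', c1, c2]
      left
      linear_combination (g p.1 * g p.2) * hτ
  have hO : Opt S U f g' := by
    refine ⟨hUg, h.fL, h.f1, hg'L, hg'1, le_antisymm (hB U hUg f g' h.fL h.f1 hg'L hg'1) ?_⟩
    rw [hUf, hUg', ← h.eq]
    linarith
  obtain ⟨x, hxZ, hx⟩ := (hfreq.and_eventually (hO.eigf hB)).exists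
  have hx0 : f x = 0 := hxZ
  rw [hx0, mul_zero] at hx
  have : op U f x = ∫ y, f y ∂unitInt := by
    unfold op
    congr 1; ext y
    by_cases c : y ∈ Z
    · have : f y = 0 := c
      simp [this]
    · simp [hUdef, hxZ, c]
  rw [this] at hx
  have h0 := (integral_eq_zero_iff_of_nonneg hf0 h.fL.int).1 hx
  have : nn f = 0 := by
    unfold nn
    have : (fun x => f x ^ 2) =ᵐ[unitInt] 0 := by
      filter_upwards [h0] with x hx
      simp [hx]
    rw [integral_congr_ae this]; simp
  linarith [h.f1]

/-- normal form of the pair of eigenfunctions -/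
lemma exists_nice {S W f g} (hB : Bd S) (hS : 1 < S) (h : Opt S W f g) :
    ∃ f' g' C, Opt S W f' g' ∧ (∀ x, 0 < f' x) ∧ (∀ x, |f' x| ≤ C) ∧ (∀ x, |g' x| ≤ C) := by
  classical
  have h1 := h.abs hB
  set F : ℝ → ℝ := fun x => |f x| with hF
  have hpos := h1.pos hB (fun x => abs_nonneg _)
  have hmu := h1.mu_pos hB hS
  have hnu := h1.nu_neg hS
  set m := EE W F F
  set n := EE W g g
  set f' : ℝ → ℝ := fun x => if 0 < op W F x / m then op W F x / m else 1 with hf'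
  set g' : ℝ → ℝ := fun x => op W g x / n with hg'
  have mf0 : Measurable (fun x => op W F x / m) := (op_meas h.gr.ker h1.fL.1).div_const m
  have mg : Measurable g' := (op_meas h.gr.ker h1.gL.1).div_const n
  have mf : Measurable f' :=
    Measurable.ite (measurableSet_lt measurable_const mf0) mf0 measurable_const
  have ef : F =ᵐ[unitInt] f' := by
    filter_upwards [h1.eigf hB, hpos] with x hx hx2
    have : op W F x / m = F x := by rw [hx]; exact mul_div_cancel_left₀ _ hmu.ne'
    simp only [hf', this]
    rw [if_pos hx2]
  have eg : g =ᵐ[unitInt] g' := by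
    filter_upwards [h1.eigg hB] with x hx
    simp only [hg']
    rw [hx]
    exact (mul_div_cancel_left₀ _ hnu.ne).symm
  set C1 := (∫ y, |F y| ∂unitInt) / m
  set C2 := (∫ y, |g y| ∂unitInt) / |n|
  refine ⟨f', g', max (max C1 C2) 1, h1.congr ef eg mf mg, ?_, ?_, ?_⟩
  · intro x
    simp only [hf']
    split_ifs with hc
    · exact hc
    · norm_num
  · intro x
    simp only [hf']
    split_ifs with hc
    · refine le_trans ?_ ((le_max_left C1 C2).trans (le_max_left _ _))
      rw [abs_div, abs_of_pos hmu]
      exact div_le_div_of_nonneg_right (op_bound h.gr.ker h1.fL.int x) hmu.le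
    · simp
  · intro x
    refine le_trans ?_ ((le_max_right C1 C2).trans (le_max_left _ _))
    simp only [hg']
    rw [abs_div]
    exact div_le_div_of_nonneg_right (op_bound h.gr.ker h1.gL.int x) (abs_nonneg _)

end GS

namespace GS
open Filter Topology

/-- The threshold kernel. -/
noncomputable def K0 (f g : ℝ → ℝ) (x y : ℝ) : ℝ := if g x * g y < f x * f y then 1 else 0

lemma freq_neg {f g : ℝ → ℝ} (hf : ∀ x, 0 < f x) (fL : L2 f) (gL : L2 g) (g1 : nn g = 1)
    (ho : ∫ x, f x * g x ∂unitInt = 0) : ∃ᶠ x in ae unitInt, g x < 0 := by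
  intro hcon
  have h1 : 0 ≤ᵐ[unitInt] fun x => f x * g x := by
    filter_upwards [hcon] with x hx
    exact mul_nonneg (hf x).le (not_lt.1 hx)
  have h2 := (integral_eq_zero_iff_of_nonneg_ae h1 (fL.mul gL)).1 ho
  have : nn g = 0 := by
    unfold nn
    have : (fun x => g x ^ 2) =ᵐ[unitInt] 0 := by
      filter_upwards [h2] with x hx
      rcases mul_eq_zero.1 hx with e | e
      · exact absurd e (hf x).ne'
      · simp [e]
    rw [integral_congr_ae this]; simp
  linarith

lemma J_eq {W f g} (hW : Ker W) (fL : L2 f) (gL : L2 g) : EE W f f - EE W g g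
    = ∫ p, W p.1 p.2 * (f p.1 * f p.2 - g p.1 * g p.2) ∂(unitInt.prod unitInt) := by
  unfold EE
  rw [← integral_sub (EE_int hW fL.int fL.int) (EE_int hW gL.int gL.int)]
  congr 1; ext p; ring

lemma J_int {W f g} (hW : Ker W) (fL : L2 f) (gL : L2 g) :
    Integrable (fun p : ℝ × ℝ => W p.1 p.2 * (f p.1 * f p.2 - g p.1 * g p.2))
      (unitInt.prod unitInt) := by
  refine ((EE_int hW fL.int fL.int).sub (EE_int hW gL.int gL.int)).congr ?_
  filter_upwards with p
  simp only [Pi.sub_apply]; ring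

lemma meas_lt {f g : ℝ → ℝ} (hf : Measurable f) (hg : Measurable g) :
    MeasurableSet {p : ℝ × ℝ | g p.1 * g p.2 < f p.1 * f p.2} :=
  measurableSet_lt ((hg.comp measurable_fst).mul (hg.comp measurable_snd))
    ((hf.comp measurable_fst).mul (hf.comp measurable_snd))

lemma K0_graphon {f g : ℝ → ℝ} (hf : Measurable f) (hg : Measurable g) : IsGraphon (K0 f g) := by
  refine ⟨?_, ?_, ?_⟩
  · exact Measurable.ite (meas_lt hf hg) measurable_const measurable_const
  · intro x y
    unfold K0
    split_ifs <;> norm_num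
  · filter_upwards with p
    unfold K0
    rw [mul_comm (g p.1), mul_comm (f p.1)]

lemma Opt.thresh {S W f g} (hB : Bd S) (h : Opt S W f g) :
    (∀ᵐ p : ℝ × ℝ ∂(unitInt.prod unitInt), (g p.1 * g p.2 < f p.1 * f p.2 → W p.1 p.2 = 1) ∧
      (f p.1 * f p.2 < g p.1 * g p.2 → W p.1 p.2 = 0)) := by
  have hK := K0_graphon h.fL.1 h.gL.1
  have h1 := hB _ hK f g h.fL h.f1 h.gL h.g1
  rw [← h.eq, J_eq hK.ker h.fL h.gL, J_eq h.gr.ker h.fL h.gL, ← sub_nonpos,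
    ← integral_sub (J_int hK.ker h.fL h.gL) (J_int h.gr.ker h.fL h.gL)] at h1
  have hnn : ∀ p : ℝ × ℝ, 0 ≤ K0 f g p.1 p.2 * (f p.1 * f p.2 - g p.1 * g p.2)
      - W p.1 p.2 * (f p.1 * f p.2 - g p.1 * g p.2) := by
    intro p
    have := h.gr.2.1 p.1 p.2
    unfold K0
    split_ifs with hc
    · nlinarith [this.2]
    · nlinarith [this.1]
  have h2 := (integral_eq_zero_iff_of_nonneg hnn
    ((J_int hK.ker h.fL h.gL).sub (J_int h.gr.ker h.fL h.gL))).1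
    (le_antisymm h1 (integral_nonneg hnn))
  filter_upwards [h2] with p hp
  simp only [Pi.zero_apply] at hp
  rw [← sub_mul] at hp
  constructor
  · intro hc
    have e : K0 f g p.1 p.2 = 1 := if_pos hc
    rcases mul_eq_zero.1 hp with e' | e' <;> linarith
  · intro hc
    have e : K0 f g p.1 p.2 = 0 := if_neg (not_lt.2 hc.le)
    rcases mul_eq_zero.1 hp with e' | e' <;> linarith

lemma Opt.of_thresh {S W U f g} (hB : Bd S) (h : Opt S W f g) (hU : IsGraphon U)
    (hU2 : ∀ p : ℝ × ℝ, (g p.1 * g p.2 < f p.1 * f p.2 → U p.1 p.2 = 1) ∧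
      (f p.1 * f p.2 < g p.1 * g p.2 → U p.1 p.2 = 0)) : Opt S U f g := by
  refine ⟨hU, h.fL, h.f1, h.gL, h.g1, ?_⟩
  rw [← h.eq, J_eq hU.ker h.fL h.gL, J_eq h.gr.ker h.fL h.gL]
  refine integral_congr_ae ?_
  filter_upwards [h.thresh hB] with p hp
  rcases lt_trichotomy (g p.1 * g p.2) (f p.1 * f p.2) with c | c | c
  · rw [hp.1 c, (hU2 p).1 c]
  · rw [c]; ring
  · rw [hp.2 c, (hU2 p).2 c]

lemma Opt.K0 {S W f g} (hB : Bd S) (h : Opt S W f g) : Opt S (K0 f g) f g :=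
  h.of_thresh hB (K0_graphon h.fL.1 h.gL.1) (fun _ => ⟨fun c => if_pos c,
    fun c => if_neg (not_lt.2 c.le)⟩)

/-- ties are null on the positive side -/
lemma Opt.ties {S W f g} (hB : Bd S) (hS : 1 < S) (h : Opt S W f g) (hf : ∀ x, 0 < f x) :
    ∀ᵐ p : ℝ × ℝ ∂(unitInt.prod unitInt), 0 < g p.1 → 0 < g p.2 →
      g p.1 * g p.2 ≠ f p.1 * f p.2 := by
  classical
  have hK := h.K0 hB
  set U : ℝ → ℝ → ℝ := fun x y => if (g x * g y = f x * f y ∧ 0 < g x ∧ 0 < g y) then 1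
    else GS.K0 f g x y with hUdef
  have hgm := h.gL.1
  have hfm := h.fL.1
  have mT : MeasurableSet {p : ℝ × ℝ | g p.1 * g p.2 = f p.1 * f p.2 ∧ 0 < g p.1 ∧ 0 < g p.2} := by
    refine MeasurableSet.inter ?_ (MeasurableSet.inter ?_ ?_)
    · exact measurableSet_eq_fun ((hgm.comp measurable_fst).mul (hgm.comp measurable_snd))
        ((hfm.comp measurable_fst).mul (hfm.comp measurable_snd))
    · exact measurableSet_lt measurable_const (hgm.comp measurable_fst)
    · exact measurableSet_lt measurable_const (hgm.comp measurable_snd)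
  have hU : IsGraphon U := by
    refine ⟨Measurable.ite mT measurable_const hK.gr.1, ?_, ?_⟩
    · intro x y
      simp only [hUdef]
      split_ifs
      · norm_num
      · exact hK.gr.2.1 x y
    · filter_upwards with p
      simp only [hUdef, GS.K0]
      rw [mul_comm (g p.1), mul_comm (f p.1)]
      simp only [and_comm (a := 0 < g p.1)]
  have hO : Opt S U f g := by
    refine h.of_thresh hB hU ?_
    intro p
    constructor
    · intro c
      simp only [hUdef]
      rw [if_neg (fun e => c.ne e.1)]
      exact if_pos c
    · intro c
      simp only [hUdef]
      rw [if_neg (fun e => c.ne' e.1)]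
      exact if_neg (not_lt.2 c.le)
  have e1 := hO.eigf hB
  have e0 := hK.eigf hB
  have hneg := freq_neg hf h.fL h.gL h.g1 (h.orth hB hS)
  have hmu : EE U f f = EE (GS.K0 f g) f f := by
    obtain ⟨x, hx, h1, h0⟩ := (hneg.and_eventually (e1.and e0)).exists
    have : op U f x = op (GS.K0 f g) f x := by
      unfold op
      congr 1; ext y
      simp only [hUdef]
      rw [if_neg (fun e => absurd e.2.1 (not_lt.2 hx.le))]
    rw [h1, h0] at this
    exact mul_right_cancel₀ (hf x).ne' this
  have hmeas : MeasurableSet {p : ℝ × ℝ | 0 < g p.1 → 0 < g p.2 → g p.1 * g p.2 ≠ f p.1 * f p.2} := by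
    convert mT.compl using 1
    ext p
    simp only [Set.mem_ofPred_eq, Set.mem_compl_iff]
    tauto
  rw [Measure.ae_prod_iff_ae_ae hmeas]
  filter_upwards [e1, e0] with x h1 h0
  rw [hmu, ← h0] at h1
  have i1 : ∀ V, IsGraphon V → Integrable (fun y => V x y * f y) unitInt := by
    intro V hV
    refine h.fL.int.bdd_mul (c := 1) (hV.1.comp measurable_prodMk_left).aestronglyMeasurable ?_
    filter_upwards with y using hV.ker.2.1 x y
  unfold op at h1
  have hz : ∫ y, (U x y * f y - GS.K0 f g x y * f y) ∂unitInt = 0 := by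
    rw [integral_sub (i1 U hU) (i1 _ hK.gr), h1, sub_self]
  have hnn : ∀ y, 0 ≤ U x y * f y - GS.K0 f g x y * f y := by
    intro y
    rw [← sub_mul]
    refine mul_nonneg ?_ (hf y).le
    simp only [hUdef]
    split_ifs
    · linarith [(hK.gr.2.1 x y).2]
    · simp
  have := (integral_eq_zero_iff_of_nonneg hnn ((i1 U hU).sub (i1 _ hK.gr))).1 hz
  filter_upwards [this] with y hy c1 c2 c3
  have a1 : U x y = 1 := if_pos ⟨c3, c1, c2⟩
  have a2 : GS.K0 f g x y = 0 := if_neg (not_lt.2 c3.ge)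
  simp only [Pi.zero_apply, a1, a2] at hy
  linarith [hf y]

/-- W is the threshold kernel almost everywhere -/
lemma Opt.eq_K0 {S W f g} (hB : Bd S) (hS : 1 < S) (h : Opt S W f g) (hf : ∀ x, 0 < f x) :
    ∀ᵐ p : ℝ × ℝ ∂(unitInt.prod unitInt), W p.1 p.2 = GS.K0 f g p.1 p.2 := by
  filter_upwards [h.thresh hB, h.ties hB hS hf, h.neg.ties hB hS hf] with p h1 h2 h3
  unfold GS.K0
  split_ifs with hc
  · exact h1.1 hc
  · refine h1.2 (lt_of_le_of_ne (not_lt.1 hc) ?_)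
    intro e
    have hpos : 0 < g p.1 * g p.2 := by rw [← e]; exact mul_pos (hf _) (hf _)
    rcases pos_and_pos_or_neg_and_neg_of_mul_pos hpos with c | c
    · exact h2 c.1 c.2 e.symm
    · exact h3 (by linarith [c.1]) (by linarith [c.2]) (by rw [e]; ring)

end GS

namespace GS
open Filter Topology

lemma exists_T (P : Measure ℝ) [IsProbabilityMeasure P] :
    ∃ T : ℝ → ℝ, Measurable T ∧ unitInt.map T = P := by
  obtain ⟨f, hf, hP⟩ := Measure.exists_measurable_map_eq P
  have hpr : Measurable (Set.projIcc (0:ℝ) 1 zero_le_one) := continuous_projIcc.measurable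
  refine ⟨fun x => f (Set.projIcc (0:ℝ) 1 zero_le_one x), hf.comp hpr, ?_⟩
  have h1 : unitInt = Measure.map (Subtype.val : unitInterval → ℝ) volume := by
    unfold unitInt
    exact (map_comap_subtype_coe measurableSet_Icc volume).symm
  have hm : Measurable (fun x => f (Set.projIcc (0:ℝ) 1 zero_le_one x)) := hf.comp hpr
  rw [h1, Measure.map_map hm measurable_subtype_coe, ← hP]
  congr 1
  ext x
  simp

/-- The data of a bounded probability density. -/
structure Dens (ρ : ℝ → ℝ) : Prop where
  m : Measurable ρ
  nonneg : ∀ x, 0 ≤ ρ x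
  bdd : ∃ C, ∀ x, |ρ x| ≤ C
  one : ∫ x, ρ x ∂unitInt = 1

lemma Dens.int {ρ} (h : Dens ρ) : Integrable ρ unitInt := by
  obtain ⟨C, hC⟩ := h.bdd
  exact (L2.of_bdd h.m C hC).int

lemma Dens.exists_T {ρ} (h : Dens ρ) : ∃ T : ℝ → ℝ, Measurable T ∧
    (∀ φ : ℝ → ℝ, Measurable φ → ∫ u, φ (T u) ∂unitInt = ∫ x, ρ x * φ x ∂unitInt) ∧
    (∀ p : ℝ → Prop, MeasurableSet {x | p x} →
      (∀ᵐ u ∂unitInt, p (T u)) → ∀ᵐ x ∂unitInt, 0 < ρ x → p x) := by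
  have hP : IsProbabilityMeasure (unitInt.withDensity (fun x => ENNReal.ofReal (ρ x))) := by
    refine ⟨?_⟩
    rw [withDensity_apply _ MeasurableSet.univ, Measure.restrict_univ]
    rw [← ofReal_integral_eq_lintegral_ofReal h.int (Eventually.of_forall h.nonneg), h.one]
    simp
  obtain ⟨T, hT, hm⟩ := GS.exists_T (unitInt.withDensity (fun x => ENNReal.ofReal (ρ x)))
  refine ⟨T, hT, ?_, ?_⟩
  · intro φ hφ
    rw [← integral_map (φ := T) hT.aemeasurable hφ.aestronglyMeasurable, hm,
      integral_withDensity_eq_integral_toReal_smul h.m.ennreal_ofReal (by simp)]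
    congr 1; ext x
    rw [ENNReal.toReal_ofReal (h.nonneg x), smul_eq_mul]
  · intro p hp hh
    have h2 : ∀ᵐ x ∂(unitInt.map T), p x := (ae_map_iff hT.aemeasurable hp).2 hh
    rw [hm, ae_withDensity_iff h.m.ennreal_ofReal] at h2
    filter_upwards [h2] with x hx h0
    exact hx (by simpa using h0)

lemma dens_main {S K ρ φ ψ} (hB : Bd S) (hK : IsGraphon K) (hs : ∀ x y, K x y = K y x)
    (h : Dens ρ) (C : ℝ) (mφ : Measurable φ) (bφ : ∀ x, |φ x| ≤ C) (mψ : Measurable ψ)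
    (bψ : ∀ x, |ψ x| ≤ C) (φ1 : ∫ x, ρ x * φ x ^ 2 ∂unitInt = 1)
    (ψ1 : ∫ x, ρ x * ψ x ^ 2 ∂unitInt = 1) :
    EE K (fun x => ρ x * φ x) (fun x => ρ x * φ x)
      - EE K (fun x => ρ x * ψ x) (fun x => ρ x * ψ x) ≤ S ∧
    (EE K (fun x => ρ x * φ x) (fun x => ρ x * φ x)
      - EE K (fun x => ρ x * ψ x) (fun x => ρ x * ψ x) = S →
      ∀ᵐ x ∂unitInt, 0 < ρ x → op K (fun x => ρ x * φ x) x
        = EE K (fun x => ρ x * φ x) (fun x => ρ x * φ x) * φ x) := by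
  obtain ⟨T, hT, h1, h2⟩ := h.exists_T
  obtain ⟨D, hD⟩ := h.bdd
  set U : ℝ → ℝ → ℝ := fun x y => K (T x) (T y) with hU
  have hUg : IsGraphon U := by
    refine ⟨?_, fun x y => hK.2.1 _ _, Eventually.of_forall fun p => hs _ _⟩
    exact hK.1.comp ((hT.comp measurable_fst).prodMk (hT.comp measurable_snd))
  have Lρ : ∀ χ : ℝ → ℝ, Measurable χ → (∀ x, |χ x| ≤ C) → L2 (fun x => ρ x * χ x) := by
    intro χ mχ bχ
    refine L2.of_bdd (h.m.mul mχ) (D * C) (fun x => ?_)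
    rw [abs_mul]
    exact mul_le_mul (hD x) (bχ x) (abs_nonneg _) ((abs_nonneg _).trans (hD x))
  have hop : ∀ χ : ℝ → ℝ, Measurable χ → ∀ u,
      op U (fun x => χ (T x)) u = op K (fun x => ρ x * χ x) (T u) := by
    intro χ mχ u
    unfold op
    rw [h1 (fun y => K (T u) y * χ y) ((hK.1.comp measurable_prodMk_left).mul mχ)]
    congr 1; ext y; ring
  have hEE : ∀ χ : ℝ → ℝ, Measurable χ → (∀ x, |χ x| ≤ C) →
      EE U (fun x => χ (T x)) (fun x => χ (T x))
        = EE K (fun x => ρ x * χ x) (fun x => ρ x * χ x) := by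
    intro χ mχ bχ
    have L : L2 (fun x => χ (T x)) := L2.of_bdd (mχ.comp hT) C (fun x => bχ _)
    rw [EE_eq_op hUg.ker L.int L.int, EE_eq_op hK.ker (Lρ χ mχ bχ).int (Lρ χ mχ bχ).int]
    have := h1 (fun x => χ x * op K (fun x => ρ x * χ x) x)
      (mχ.mul (op_meas hK.ker (h.m.mul mχ)))
    rw [show (∫ x, χ (T x) * op U (fun x => χ (T x)) x ∂unitInt)
      = ∫ x, χ (T x) * op K (fun x => ρ x * χ x) (T x) ∂unitInt by simp_rw [hop χ mχ], this]
    congr 1; ext x; ring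
  have n1 : nn (fun x => φ (T x)) = 1 := (h1 (fun x => φ x ^ 2) (mφ.pow_const 2)).trans φ1
  have n2 : nn (fun x => ψ (T x)) = 1 := (h1 (fun x => ψ x ^ 2) (mψ.pow_const 2)).trans ψ1
  have L1 : L2 (fun x => φ (T x)) := L2.of_bdd (mφ.comp hT) C (fun x => bφ _)
  have L2' : L2 (fun x => ψ (T x)) := L2.of_bdd (mψ.comp hT) C (fun x => bψ _)
  rw [← hEE φ mφ bφ, ← hEE ψ mψ bψ]
  refine ⟨hB U hUg _ _ L1 n1 L2' n2, fun he => ?_⟩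
  have hO : Opt S U (fun x => φ (T x)) (fun x => ψ (T x)) := ⟨hUg, L1, n1, L2', n2, he⟩
  refine h2 (fun x => op K (fun x => ρ x * φ x) x
    = EE U (fun x => φ (T x)) (fun x => φ (T x)) * φ x) ?_ ?_
  · exact measurableSet_eq_fun (op_meas hK.ker (h.m.mul mφ)) (measurable_const.mul mφ)
  · filter_upwards [hO.eigf hB] with u hu
    rw [← hop φ mφ, hu]

/-- homogeneous form of the inequality -/
lemma dens_hom {S K ρ φ ψ} (hB : Bd S) (hK : IsGraphon K) (hs : ∀ x y, K x y = K y x)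
    (h : Dens ρ) (C : ℝ) (mφ : Measurable φ) (bφ : ∀ x, |φ x| ≤ C) (mψ : Measurable ψ)
    (bψ : ∀ x, |ψ x| ≤ C) {A B : ℝ} (hA : 0 < A) (hB' : 0 < B)
    (φ1 : ∫ x, ρ x * φ x ^ 2 ∂unitInt = A)
    (ψ1 : ∫ x, ρ x * ψ x ^ 2 ∂unitInt = B) :
    EE K (fun x => ρ x * φ x) (fun x => ρ x * φ x) / A
      - EE K (fun x => ρ x * ψ x) (fun x => ρ x * ψ x) / B ≤ S := by
  have key : ∀ (D : ℝ) (χ : ℝ → ℝ), 0 < D → ∫ x, ρ x * χ x ^ 2 ∂unitInt = D →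
      ∫ x, ρ x * ((Real.sqrt D)⁻¹ * χ x) ^ 2 ∂unitInt = 1 ∧
      EE K (fun x => ρ x * ((Real.sqrt D)⁻¹ * χ x)) (fun x => ρ x * ((Real.sqrt D)⁻¹ * χ x))
        = EE K (fun x => ρ x * χ x) (fun x => ρ x * χ x) / D := by
    intro D χ hD h1
    have hq : (Real.sqrt D)⁻¹ ^ 2 = D⁻¹ := by rw [inv_pow, Real.sq_sqrt hD.le]
    constructor
    · have : ∀ x, ρ x * ((Real.sqrt D)⁻¹ * χ x) ^ 2 = D⁻¹ * (ρ x * χ x ^ 2) := by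
        intro x; rw [mul_pow, hq]; ring
      simp_rw [this]
      rw [integral_const_mul, h1, inv_mul_cancel₀ hD.ne']
    · have : (fun x => ρ x * ((Real.sqrt D)⁻¹ * χ x))
          = fun x => (Real.sqrt D)⁻¹ * (ρ x * χ x) := by ext x; ring
      rw [this, EE_smul, ← pow_two, hq]; field_simp
  obtain ⟨a1, a2⟩ := key A φ hA φ1
  obtain ⟨b1, b2⟩ := key B ψ hB' ψ1
  have bb : ∀ (D : ℝ) (χ : ℝ → ℝ), (∀ x, |χ x| ≤ C) → ∀ x,
      |(Real.sqrt D)⁻¹ * χ x| ≤ (Real.sqrt D)⁻¹ * C := by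
    intro D χ hχ x
    rw [abs_mul, abs_of_nonneg (by positivity)]
    exact mul_le_mul_of_nonneg_left (hχ x) (by positivity)
  have := (dens_main (φ := fun x => (Real.sqrt A)⁻¹ * φ x) (ψ := fun x => (Real.sqrt B)⁻¹ * ψ x)
    hB hK hs h (max ((Real.sqrt A)⁻¹ * C) ((Real.sqrt B)⁻¹ * C)) (mφ.const_mul _)
    (fun x => (bb A φ bφ x).trans (le_max_left _ _)) (mψ.const_mul _)
    (fun x => (bb B ψ bψ x).trans (le_max_right _ _)) a1 b1).1
  rwa [a2, b2] at this

end GS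

namespace GS
open Filter Topology

/-- The normalised extremal situation. -/
structure Nice (S : ℝ) (f g : ℝ → ℝ) (C : ℝ) : Prop where
  hB : Bd S
  hS : 1 < S
  opt : Opt S (K0 f g) f g
  pos : ∀ x, 0 < f x
  bf : ∀ x, |f x| ≤ C
  bg : ∀ x, |g x| ≤ C

lemma K0_symm (f g : ℝ → ℝ) (x y : ℝ) : K0 f g x y = K0 f g y x := by
  unfold K0; rw [mul_comm (g x), mul_comm (f x)]

/-- perturbation directions -/
structure Dir (s : ℝ → ℝ) : Prop where
  m : Measurable s
  b : ∀ x, |s x| ≤ 1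
  z : ∫ x, s x ∂unitInt = 0

lemma Dir.int {s} (h : Dir s) : Integrable s unitInt := (L2.of_bdd h.m 1 h.b).int

lemma Dir.dens {s} (h : Dir s) {ε : ℝ} (h0 : 0 ≤ ε) (h1 : ε ≤ 1/2) :
    Dens (fun x => 1 + ε * s x) := by
  refine ⟨(h.m.const_mul ε).const_add 1, fun x => ?_, ⟨2, fun x => ?_⟩, ?_⟩
  · have := abs_le.1 (h.b x); nlinarith
  · have := abs_le.1 (h.b x); rw [abs_le]; constructor <;> nlinarith
  · rw [integral_add (integrable_const _) (h.int.const_mul ε), integral_const_mul, h.z]; simp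

lemma Dir.mulL2 {s φ} (h : Dir s) (hφ : L2 φ) : L2 (fun x => s x * φ x) := by
  refine ⟨h.m.mul hφ.1, ?_⟩
  refine Integrable.mono' hφ.2 ((h.m.mul hφ.1).pow_const 2).aestronglyMeasurable ?_
  filter_upwards with x
  rw [Real.norm_of_nonneg (sq_nonneg _), mul_pow]
  have := abs_le.1 (h.b x)
  have h2 : s x ^ 2 ≤ 1 := by nlinarith
  nlinarith [sq_nonneg (φ x)]

lemma Dir.int2 {s φ} (h : Dir s) (hφ : L2 φ) : Integrable (fun x => s x * φ x ^ 2) unitInt := by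
  have := (h.mulL2 hφ).mul hφ
  refine this.congr ?_
  filter_upwards with x; ring

lemma Dir.abs_le {s φ} (h : Dir s) (hφ : L2 φ) (h1 : nn φ = 1) :
    |∫ x, s x * φ x ^ 2 ∂unitInt| ≤ 1 := by
  rw [← h1]
  unfold nn
  rw [← Real.norm_eq_abs]
  refine norm_integral_le_of_norm_le hφ.2 ?_
  filter_upwards with x
  rw [Real.norm_eq_abs, abs_mul, abs_of_nonneg (sq_nonneg (φ x))]
  nlinarith [h.b x, sq_nonneg (φ x)]

lemma Dir.intA {s φ} (h : Dir s) (hφ : L2 φ) (h1 : nn φ = 1) (ε : ℝ) :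
    ∫ x, (1 + ε * s x) * φ x ^ 2 ∂unitInt = 1 + ε * ∫ x, s x * φ x ^ 2 ∂unitInt := by
  have e : ∀ x, (1 + ε * s x) * φ x ^ 2 = φ x ^ 2 + ε * (s x * φ x ^ 2) := fun x => by ring
  simp_rw [e]
  rw [integral_add hφ.2 ((h.int2 hφ).const_mul ε), integral_const_mul]
  unfold nn at h1; rw [h1]

lemma Dir.EEexp {k s φ lam} (hk : Ker k) (h : Dir s) (hφ : L2 φ)
    (heig : ∀ᵐ x ∂unitInt, op k φ x = lam * φ x) (ε : ℝ) :
    EE k (fun x => (1 + ε * s x) * φ x) (fun x => (1 + ε * s x) * φ x)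
      = EE k φ φ + 2 * ε * lam * (∫ x, s x * φ x ^ 2 ∂unitInt)
        + ε ^ 2 * EE k (fun x => s x * φ x) (fun x => s x * φ x) := by
  have hL := h.mulL2 hφ
  have e : (fun x => (1 + ε * s x) * φ x) = fun x => φ x + ε * (s x * φ x) := by ext x; ring
  rw [e, EE_add hk hφ.int (hL.smul ε).int, EE_smul k ε ε]
  have e2 : EE k φ (fun x => ε * (s x * φ x)) = ε * EE k φ (fun x => s x * φ x) := by
    have := EE_smul k 1 ε φ (fun x => s x * φ x)
    simpa using this
  have e3 : EE k φ (fun x => s x * φ x) = lam * ∫ x, s x * φ x ^ 2 ∂unitInt := by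
    rw [EE_symm hk, EE_eq_op hk hL.int hφ.int, ← integral_const_mul]
    refine integral_congr_ae ?_
    filter_upwards [heig] with x hx
    rw [hx]; ring
  rw [e2, e3]; ring

lemma Nice.pert {S f g C s} (N : Nice S f g C) (h : Dir s) {ε : ℝ} (h0 : 0 ≤ ε) (h1 : ε ≤ 1/2)
    {a b Qf Qg μ ν : ℝ} (hμ : EE (K0 f g) f f = μ) (hν : EE (K0 f g) g g = ν)
    (ha : ∫ x, s x * f x ^ 2 ∂unitInt = a)
    (hb : ∫ x, s x * g x ^ 2 ∂unitInt = b)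
    (hQf : EE (K0 f g) (fun x => s x * f x) (fun x => s x * f x) = Qf)
    (hQg : EE (K0 f g) (fun x => s x * g x) (fun x => s x * g x) = Qg) :
    (μ + 2 * ε * μ * a + ε ^ 2 * Qf) / (1 + ε * a)
      - (ν + 2 * ε * ν * b + ε ^ 2 * Qg) / (1 + ε * b) ≤ S := by
  have hO := N.opt
  have a1 := _root_.abs_le.1 (h.abs_le hO.fL hO.f1)
  have b1 := _root_.abs_le.1 (h.abs_le hO.gL hO.g1)
  rw [ha] at a1; rw [hb] at b1
  have := dens_hom N.hB hO.gr (K0_symm f g) (h.dens h0 h1) C hO.fL.1 N.bf hO.gL.1 N.bg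
    (A := 1 + ε * a) (B := 1 + ε * b) (by nlinarith) (by nlinarith)
    (by rw [h.intA hO.fL hO.f1, ha]) (by rw [h.intA hO.gL hO.g1, hb])
  rw [h.EEexp hO.gr.ker hO.fL (hO.eigf N.hB), h.EEexp hO.gr.ker hO.gL (hO.eigg N.hB),
    ha, hb, hQf, hQg, hμ, hν] at this
  exact this

lemma Nice.first {S f g C s} (N : Nice S f g C) (h : Dir s) :
    EE (K0 f g) f f * (∫ x, s x * f x ^ 2 ∂unitInt)
      - EE (K0 f g) g g * (∫ x, s x * g x ^ 2 ∂unitInt) ≤ 0 := by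
  have hO := N.opt
  have a1 := _root_.abs_le.1 (h.abs_le hO.fL hO.f1)
  have b1 := _root_.abs_le.1 (h.abs_le hO.gL hO.g1)
  have heq := hO.eq
  have hmu := hO.mu_pos N.hB N.hS
  have hnu := hO.nu_neg N.hS
  have key := fun (ε : ℝ) (h0 : 0 ≤ ε) (h1 : ε ≤ 1/2) => N.pert h h0 h1 rfl rfl rfl rfl rfl rfl
  generalize EE (K0 f g) f f = μ at *
  generalize EE (K0 f g) g g = ν at *
  generalize ∫ x, s x * f x ^ 2 ∂unitInt = a at *
  generalize ∫ x, s x * g x ^ 2 ∂unitInt = b at *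
  generalize EE (K0 f g) (fun x => s x * f x) (fun x => s x * f x) = Qf at *
  generalize EE (K0 f g) (fun x => s x * g x) (fun x => s x * g x) = Qg at *
  have aux : ∀ (ε m c Q : ℝ), 0 < ε → ε ≤ 1/2 → -1 ≤ c → c ≤ 1 →
      |(m + 2 * ε * m * c + ε ^ 2 * Q) / (1 + ε * c) - (m + ε * (m * c))|
        ≤ ε ^ 2 * (2 * (|Q| + |m|)) := by
    intro ε m c Q h0 h1 c0 c1
    have hp : (1/2 : ℝ) ≤ 1 + ε * c := by nlinarith
    have hp' : (0 : ℝ) < 1 + ε * c := by linarith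
    have e : (m + 2 * ε * m * c + ε ^ 2 * Q) / (1 + ε * c) - (m + ε * (m * c))
        = ε ^ 2 * ((Q - m * c ^ 2) / (1 + ε * c)) := by
      field_simp; ring
    rw [e, abs_mul, abs_of_pos (by positivity : 0 < ε ^ 2)]
    refine mul_le_mul_of_nonneg_left ?_ (by positivity)
    rw [abs_div, abs_of_pos hp', div_le_iff₀ hp']
    have h2 : |Q - m * c ^ 2| ≤ |Q| + |m| := by
      refine (abs_sub _ _).trans ?_
      rw [abs_mul, abs_of_nonneg (sq_nonneg c)]
      have : c ^ 2 ≤ 1 := by nlinarith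
      nlinarith [abs_nonneg m]
    nlinarith [abs_nonneg Q, abs_nonneg m]
  set M := 2 * (|Qf| + |μ|) + 2 * (|Qg| + |ν|) with hM
  have hM0 : 0 ≤ M := by positivity
  have k2 : ∀ ε : ℝ, 0 < ε → ε ≤ 1/2 → μ * a - ν * b ≤ ε * M := by
    intro ε h0 h1
    have k := key ε h0.le h1
    have x1 := _root_.abs_le.1 (aux ε μ a Qf h0 h1 a1.1 a1.2)
    have x2 := _root_.abs_le.1 (aux ε ν b Qg h0 h1 b1.1 b1.2)
    have : ε * (μ * a - ν * b) ≤ ε * (ε * M) := by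
      rw [hM]; nlinarith
    exact le_of_mul_le_mul_left this h0
  by_contra hc
  push Not at hc
  have hD : 0 < 2 * (M + 1) + 2 * (μ * a - ν * b) := by positivity
  have := k2 ((μ * a - ν * b) / (2 * (M + 1) + 2 * (μ * a - ν * b))) (by positivity) (by
    rw [div_le_div_iff₀ hD (by norm_num)]; nlinarith)
  rw [div_mul_eq_mul_div, le_div_iff₀ hD] at this
  nlinarith

lemma Nice.ellipse {S f g C} (N : Nice S f g C) :
    ∀ᵐ x ∂unitInt, EE (K0 f g) f f * f x ^ 2 - EE (K0 f g) g g * g x ^ 2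
      = EE (K0 f g) f f - EE (K0 f g) g g := by
  have hO := N.opt
  have hmu := hO.mu_pos N.hB N.hS
  have hnu := hO.nu_neg N.hS
  have hfirst := fun s h => N.first (s := s) h
  have f1 := hO.f1
  have g1 := hO.g1
  unfold nn at f1 g1
  generalize EE (K0 f g) f f = μ at *
  generalize EE (K0 f g) g g = ν at *
  set q : ℝ → ℝ := fun x => μ * f x ^ 2 - ν * g x ^ 2 - (μ - ν) with hq
  have mq : Measurable q :=
    (((hO.fL.1.pow_const 2).const_mul μ).sub ((hO.gL.1.pow_const 2).const_mul ν)).sub_const _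
  have hC : 0 ≤ C := (abs_nonneg _).trans (N.bf 0)
  set D : ℝ := (μ - ν) * C ^ 2 + (μ - ν) + 1 with hD
  have hD0 : 0 < D := by have : 0 < μ - ν := by linarith
                         positivity
  have bq : ∀ x, |q x| ≤ D := by
    intro x
    have h1 : f x ^ 2 ≤ C ^ 2 := sq_le_sq.2 ((N.bf x).trans (le_abs_self C))
    have h2 : g x ^ 2 ≤ C ^ 2 := sq_le_sq.2 ((N.bg x).trans (le_abs_self C))
    have p1 : μ * f x ^ 2 ≤ μ * C ^ 2 := mul_le_mul_of_nonneg_left h1 hmu.le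
    have p2 : -ν * g x ^ 2 ≤ -ν * C ^ 2 := mul_le_mul_of_nonneg_left h2 (by linarith)
    have p3 : 0 ≤ μ * f x ^ 2 := by positivity
    have p4 : 0 ≤ -ν * g x ^ 2 := mul_nonneg (by linarith) (sq_nonneg _)
    rw [abs_le]; simp only [hq, hD]
    constructor <;> nlinarith [sq_nonneg C]
  have iq : Integrable q unitInt := (L2.of_bdd mq D bq).int
  have i1 : Integrable (fun x => μ * f x ^ 2) unitInt := hO.fL.2.const_mul μ
  have i2 : Integrable (fun x => ν * g x ^ 2) unitInt := hO.gL.2.const_mul ν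
  have i12 : Integrable (fun x => μ * f x ^ 2 - ν * g x ^ 2) unitInt := i1.sub i2
  have zq : ∫ x, q x ∂unitInt = 0 := by
    simp only [hq]
    rw [integral_sub i12 (integrable_const _), integral_sub i1 i2, integral_const_mul,
      integral_const_mul, f1, g1]
    simp
  have hs : Dir (fun x => D⁻¹ * q x) := by
    refine ⟨mq.const_mul _, fun x => ?_, ?_⟩
    · rw [abs_mul, abs_of_pos (inv_pos.2 hD0), inv_mul_le_iff₀ hD0]; simpa using bq x
    · rw [integral_const_mul, zq, mul_zero]
  have h1 := hfirst _ hs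
  have j1 : Integrable (fun x => μ * (D⁻¹ * q x * f x ^ 2)) unitInt := (hs.int2 hO.fL).const_mul μ
  have j2 : Integrable (fun x => ν * (D⁻¹ * q x * g x ^ 2)) unitInt := (hs.int2 hO.gL).const_mul ν
  have j3 : Integrable (fun x => (D⁻¹ * (μ - ν)) * q x) unitInt := iq.const_mul _
  have j12 : Integrable (fun x => μ * (D⁻¹ * q x * f x ^ 2) - ν * (D⁻¹ * q x * g x ^ 2)) unitInt :=
    j1.sub j2
  rw [← integral_const_mul, ← integral_const_mul, ← integral_sub j1 j2] at h1
  have h2 : ∫ x, D⁻¹ * q x ^ 2 ∂unitInt ≤ 0 := by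
    have e : ∫ x, (D⁻¹ * (μ - ν)) * q x ∂unitInt = 0 := by rw [integral_const_mul, zq, mul_zero]
    have e2 := integral_sub j12 j3
    rw [e, sub_zero] at e2
    rw [← e2] at h1
    refine le_trans (le_of_eq ?_) h1
    congr 1; ext x; simp only [hq]; ring
  rw [integral_const_mul] at h2
  have h3 : ∫ x, q x ^ 2 ∂unitInt = 0 :=
    le_antisymm (by
      by_contra hc
      push Not at hc
      have := mul_pos (inv_pos.2 hD0) hc
      linarith) (integral_nonneg fun _ => sq_nonneg _)
  have h4 := (integral_eq_zero_iff_of_nonneg (fun _ => sq_nonneg _) (L2.of_bdd mq D bq).2).1 h3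
  filter_upwards [h4] with x hx
  have : q x = 0 := by simpa using hx
  simp only [hq] at this
  linarith

end GS

namespace GS
open Filter Topology

lemma Nice.b_zero {S f g C s} (N : Nice S f g C) (h : Dir s)
    (ha : ∫ x, s x * f x ^ 2 ∂unitInt = 0) : ∫ x, s x * g x ^ 2 ∂unitInt = 0 := by
  have hO := N.opt
  have hnu := hO.nu_neg N.hS
  have hell := N.ellipse
  generalize EE (K0 f g) f f = μ at *
  generalize EE (K0 f g) g g = ν at *
  have i1 : Integrable (fun x => μ * (s x * f x ^ 2)) unitInt := (h.int2 hO.fL).const_mul μ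
  have i3 : Integrable (fun x => (μ - ν) * s x) unitInt := h.int.const_mul _
  have e : ∫ x, ν * (s x * g x ^ 2) ∂unitInt
      = ∫ x, (μ * (s x * f x ^ 2) - (μ - ν) * s x) ∂unitInt := by
    refine integral_congr_ae ?_
    filter_upwards [hell] with x hx
    linear_combination (-(s x)) * hx
  rw [integral_sub i1 i3, integral_const_mul, integral_const_mul, integral_const_mul, ha, h.z] at e
  have : ν * ∫ x, s x * g x ^ 2 ∂unitInt = 0 := by rw [e]; ring
  exact (mul_eq_zero.1 this).resolve_left hnu.ne

lemma Nice.second_le {S f g C s} (N : Nice S f g C) (h : Dir s)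
    (ha : ∫ x, s x * f x ^ 2 ∂unitInt = 0) :
    EE (K0 f g) (fun x => s x * f x) (fun x => s x * f x)
      - EE (K0 f g) (fun x => s x * g x) (fun x => s x * g x) ≤ 0 := by
  have := N.pert h (ε := 1/2) (by norm_num) (by norm_num) rfl rfl ha (N.b_zero h ha) rfl rfl
  have h2 := N.opt.eq
  norm_num at this
  linarith

lemma Nice.second_eq {S f g C s} (N : Nice S f g C) (h : Dir s)
    (ha : ∫ x, s x * f x ^ 2 ∂unitInt = 0)
    (hf : EE (K0 f g) (fun x => s x * f x) (fun x => s x * f x) = 0)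
    (hg : EE (K0 f g) (fun x => s x * g x) (fun x => s x * g x) = 0) :
    ∀ᵐ x ∂unitInt, op (K0 f g) (fun x => s x * f x) x = 0 := by
  have hO := N.opt
  have hb := N.b_zero h ha
  have hd := h.dens (ε := 1/2) (by norm_num) (by norm_num)
  have ef := h.EEexp hO.gr.ker hO.fL (hO.eigf N.hB) (1/2)
  have eg := h.EEexp hO.gr.ker hO.gL (hO.eigg N.hB) (1/2)
  rw [ha, hf, mul_zero, mul_zero, add_zero, add_zero] at ef
  rw [hb, hg, mul_zero, mul_zero, add_zero, add_zero] at eg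
  have := (dens_main N.hB hO.gr (K0_symm f g) hd C hO.fL.1 N.bf hO.gL.1 N.bg
    (by rw [h.intA hO.fL hO.f1, ha]; simp) (by rw [h.intA hO.gL hO.g1, hb]; simp)).2
    (by rw [ef, eg]; exact hO.eq)
  filter_upwards [this, hO.eigf N.hB] with x h1 h2
  have hpos : 0 < 1 + 1/2 * s x := by have := _root_.abs_le.1 (h.b x); linarith
  have h3 := h1 hpos
  rw [ef, ← h2] at h3
  have hi : ∀ φ, L2 φ → Integrable (fun y => K0 f g x y * φ y) unitInt := by
    intro φ hφ
    refine hφ.int.bdd_mul (c := 1) (hO.gr.1.comp measurable_prodMk_left).aestronglyMeasurable ?_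
    filter_upwards with y using hO.gr.ker.2.1 x y
  have i1 := hi f hO.fL
  have i2 : Integrable (fun y => 1/2 * (K0 f g x y * (s y * f y))) unitInt :=
    (hi _ (h.mulL2 hO.fL)).const_mul (1/2)
  have e : op (K0 f g) (fun x => (1 + 1/2 * s x) * f x) x
      = op (K0 f g) f x + 1/2 * op (K0 f g) (fun x => s x * f x) x := by
    unfold op
    rw [← integral_const_mul, ← integral_add i1 i2]
    congr 1; ext y; ring
  rw [e] at h3
  linarith

lemma int_pos {h : ℝ → ℝ} {A : Set ℝ} (hi : Integrable h unitInt) (h0 : ∀ x, 0 ≤ h x)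
    (hA : ∀ x ∈ A, 0 < h x) (mA : unitInt A ≠ 0) : 0 < ∫ x, h x ∂unitInt := by
  rw [integral_pos_iff_support_of_nonneg h0 hi]
  refine lt_of_lt_of_le (pos_iff_ne_zero.2 mA) (measure_mono ?_)
  intro x hx
  exact (hA x hx).ne'

/-- three-set direction -/
lemma three_sets {f : ℝ → ℝ} {C0 : ℝ} (mf : Measurable f) (bf : ∀ x, |f x| ≤ C0)
    (pf : ∀ x, 0 < f x)
    {A B C : Set ℝ} (mA : MeasurableSet A) (mB : MeasurableSet B) (mC : MeasurableSet C)
    (pA : unitInt A ≠ 0) (pB : unitInt B ≠ 0) (pC : unitInt C ≠ 0) {s0 t0 : ℝ} (hs0 : 0 < s0)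
    (hst : s0 < t0)
    (hA : ∀ x ∈ A, f x < s0) (hB : ∀ x ∈ B, s0 < f x ∧ f x < t0) (hC : ∀ x ∈ C, t0 < f x) :
    ∃ s, Dir s ∧ ∫ x, s x * f x ^ 2 ∂unitInt = 0 ∧ (∀ x, s x ≠ 0 → x ∈ A ∪ B ∪ C) ∧
      (∫ x, s x * f x ∂unitInt ≠ 0) ∧ (∀ x ∈ C, 0 < s x) := by
  classical
  have indm : ∀ E : Set ℝ, MeasurableSet E → Measurable (E.indicator (fun _ => (1:ℝ))) :=
    fun E hE => measurable_const.indicator hE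
  have indb : ∀ (E : Set ℝ) (x : ℝ), 0 ≤ E.indicator (fun _ => (1:ℝ)) x ∧
      E.indicator (fun _ => (1:ℝ)) x ≤ 1 := by
    intro E x
    by_cases hx : x ∈ E <;> simp [hx]
  have int_of : ∀ h : ℝ → ℝ, Measurable h → (∃ D, ∀ x, |h x| ≤ D) → Integrable h unitInt :=
    fun h mh ⟨D, hD⟩ => (L2.of_bdd mh D hD).int
  set iA := A.indicator (fun _ => (1:ℝ)) with hiA
  set iB := B.indicator (fun _ => (1:ℝ)) with hiB
  set iC := C.indicator (fun _ => (1:ℝ)) with hiC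
  have I1 : ∀ E : Set ℝ, MeasurableSet E → Integrable (E.indicator (fun _ => (1:ℝ))) unitInt :=
    fun E hE => int_of _ (indm E hE) ⟨1, fun x => by
      rw [abs_of_nonneg (indb E x).1]; exact (indb E x).2⟩
  have I2 : ∀ E : Set ℝ, MeasurableSet E → ∀ φ : ℝ → ℝ, Integrable φ unitInt →
      Integrable (fun x => E.indicator (fun _ => (1:ℝ)) x * φ x) unitInt := by
    intro E hE φ hφ
    refine hφ.bdd_mul (c := 1) (indm E hE).aestronglyMeasurable ?_
    filter_upwards with x
    rw [Real.norm_eq_abs, abs_of_nonneg (indb E x).1]; exact (indb E x).2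
  have fL : L2 f := L2.of_bdd mf C0 bf
  set mA' := ∫ x, iA x ∂unitInt
  set mB' := ∫ x, iB x ∂unitInt
  set mC' := ∫ x, iC x ∂unitInt
  set qA := ∫ x, iA x * f x ^ 2 ∂unitInt
  set qB := ∫ x, iB x * f x ^ 2 ∂unitInt
  set qC := ∫ x, iC x * f x ^ 2 ∂unitInt
  have pm : ∀ E : Set ℝ, MeasurableSet E → unitInt E ≠ 0 →
      0 < ∫ x, E.indicator (fun _ => (1:ℝ)) x ∂unitInt := fun E hE hp =>
    int_pos (A := E) (I1 E hE) (fun x => (indb E x).1) (fun x hx => by simp [hx]) hp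
  -- strict comparisons of second moments
  have up : ∀ (E : Set ℝ) (c : ℝ), MeasurableSet E → unitInt E ≠ 0 → (∀ x ∈ E, f x < c) →
      ∫ x, E.indicator (fun _ => (1:ℝ)) x * f x ^ 2 ∂unitInt
        < c ^ 2 * ∫ x, E.indicator (fun _ => (1:ℝ)) x ∂unitInt := by
    intro E c hE hp hc
    have i1 : Integrable (fun x => c ^ 2 * E.indicator (fun _ => (1:ℝ)) x) unitInt :=
      (I1 E hE).const_mul _
    rw [← integral_const_mul, ← sub_pos, ← integral_sub i1 (I2 E hE _ fL.2)]
    refine int_pos (A := E) (i1.sub (I2 E hE _ fL.2)) (fun x => ?_) (fun x hx => ?_) hp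
    · by_cases hx : x ∈ E
      · simp only [hx, Set.indicator_of_mem]
        nlinarith [hc x hx, pf x]
      · simp [hx]
    · simp only [hx, Set.indicator_of_mem]
      nlinarith [hc x hx, pf x]
  have lo : ∀ (E : Set ℝ) (c : ℝ), 0 < c → MeasurableSet E → unitInt E ≠ 0 →
      (∀ x ∈ E, c < f x) → c ^ 2 * ∫ x, E.indicator (fun _ => (1:ℝ)) x ∂unitInt <
      ∫ x, E.indicator (fun _ => (1:ℝ)) x * f x ^ 2 ∂unitInt := by
    intro E c c0 hE hp hc
    have i1 : Integrable (fun x => c ^ 2 * E.indicator (fun _ => (1:ℝ)) x) unitInt :=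
      (I1 E hE).const_mul _
    rw [← integral_const_mul, ← sub_pos, ← integral_sub (I2 E hE _ fL.2) i1]
    refine int_pos (A := E) ((I2 E hE _ fL.2).sub i1) (fun x => ?_) (fun x hx => ?_) hp
    · by_cases hx : x ∈ E
      · simp only [hx, Set.indicator_of_mem]
        nlinarith [hc x hx, pf x]
      · simp [hx]
    · simp only [hx, Set.indicator_of_mem]
      nlinarith [hc x hx, pf x]
  have A0 : 0 < mA' := pm A mA pA
  have B0 : 0 < mB' := pm B mB pB
  have C0' : 0 < mC' := pm C mC pC
  have uA : qA < s0 ^ 2 * mA' := up A s0 mA pA hA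
  have lB : s0 ^ 2 * mB' < qB := lo B s0 hs0 mB pB (fun x hx => (hB x hx).1)
  have uB : qB < t0 ^ 2 * mB' := up B t0 mB pB (fun x hx => (hB x hx).2)
  have lC : t0 ^ 2 * mC' < qC := lo C t0 (hs0.trans hst) mC pC hC
  set α := mB' * qC - mC' * qB with hα
  set β := mA' * qC - mC' * qA with hβ
  set γ := mA' * qB - mB' * qA with hγ
  have hst2 : s0 ^ 2 < t0 ^ 2 := by nlinarith
  have α0 : 0 < α := by
    have h1 := mul_lt_mul_of_pos_left lC B0
    have h2 := mul_lt_mul_of_pos_left uB C0'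
    rw [hα]; nlinarith
  have γ0 : 0 < γ := by
    have h1 := mul_lt_mul_of_pos_left lB A0
    have h2 := mul_lt_mul_of_pos_left uA B0
    rw [hγ]; nlinarith
  have β0 : 0 < β := by
    have h1 := mul_lt_mul_of_pos_left lC A0
    have h2 := mul_lt_mul_of_pos_left uA C0'
    have h3 := mul_lt_mul_of_pos_left hst2 (mul_pos A0 C0')
    rw [hβ]; nlinarith
  set c := (α + β + γ)⁻¹ with hc
  have c0 : 0 < c := by positivity
  have dAB : ∀ x, x ∈ A → x ∉ B := fun x h1 h2 => by linarith [hA x h1, (hB x h2).1]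
  have dAC : ∀ x, x ∈ A → x ∉ C := fun x h1 h2 => by linarith [hA x h1, hC x h2]
  have dBC : ∀ x, x ∈ B → x ∉ C := fun x h1 h2 => by linarith [(hB x h1).2, hC x h2]
  set s : ℝ → ℝ := fun x => c * (α * iA x - β * iB x + γ * iC x) with hs
  have ms : Measurable s :=
    ((((indm A mA).const_mul α).sub ((indm B mB).const_mul β)).add
      ((indm C mC).const_mul γ)).const_mul c
  have hlin : ∀ φ : ℝ → ℝ, Integrable φ unitInt → ∫ x, s x * φ x ∂unitInt
      = c * (α * (∫ x, iA x * φ x ∂unitInt) - β * (∫ x, iB x * φ x ∂unitInt)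
        + γ * ∫ x, iC x * φ x ∂unitInt) := by
    intro φ hφ
    have k1 : Integrable (fun x => α * (iA x * φ x)) unitInt := (I2 A mA φ hφ).const_mul α
    have k2 : Integrable (fun x => β * (iB x * φ x)) unitInt := (I2 B mB φ hφ).const_mul β
    have k3 : Integrable (fun x => γ * (iC x * φ x)) unitInt := (I2 C mC φ hφ).const_mul γ
    have k12 : Integrable (fun x => α * (iA x * φ x) - β * (iB x * φ x)) unitInt := k1.sub k2
    rw [← integral_const_mul, ← integral_const_mul, ← integral_const_mul, ← integral_sub k1 k2,
      ← integral_add k12 k3, ← integral_const_mul]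
    congr 1; ext x; simp only [hs]; ring
  have z1 : ∫ x, s x ∂unitInt = 0 := by
    have := hlin (fun _ => 1) (integrable_const _)
    simp only [mul_one] at this
    rw [this]
    change c * (α * mA' - β * mB' + γ * mC') = 0
    rw [hα, hβ, hγ]; ring
  have z2 : ∫ x, s x * f x ^ 2 ∂unitInt = 0 := by
    rw [hlin _ fL.2]
    change c * (α * qA - β * qB + γ * qC) = 0
    rw [hα, hβ, hγ]; ring
  have sA : ∀ x ∈ A, s x = c * α := by
    intro x hx; simp [hs, hiA, hiB, hiC, hx, dAB x hx, dAC x hx]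
  have sB : ∀ x ∈ B, s x = -(c * β) := by
    intro x hx
    have h1 : x ∉ A := fun h => dAB x h hx
    simp [hs, hiA, hiB, hiC, hx, h1, dBC x hx]
  have sC : ∀ x ∈ C, s x = c * γ := by
    intro x hx
    have h1 : x ∉ A := fun h => dAC x h hx
    have h2 : x ∉ B := fun h => dBC x h hx
    simp [hs, hiA, hiB, hiC, hx, h1, h2]
  have s0' : ∀ x, x ∉ A → x ∉ B → x ∉ C → s x = 0 := by
    intro x h1 h2 h3; simp [hs, hiA, hiB, hiC, h1, h2, h3]
  have hcs : c * (α + β + γ) = 1 := inv_mul_cancel₀ (by positivity)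
  have cα : 0 < c * α := by positivity
  have cβ : 0 < c * β := by positivity
  have cγ : 0 < c * γ := by positivity
  have bs : ∀ x, |s x| ≤ 1 := by
    intro x
    by_cases h1 : x ∈ A
    · rw [sA x h1, abs_of_pos cα]; nlinarith
    by_cases h2 : x ∈ B
    · rw [sB x h2, abs_neg, abs_of_pos cβ]; nlinarith
    by_cases h3 : x ∈ C
    · rw [sC x h3, abs_of_pos cγ]; nlinarith
    rw [s0' x h1 h2 h3]; simp
  have hdir : Dir s := ⟨ms, bs, z1⟩
  refine ⟨s, hdir, z2, ?_, ?_, fun x hx => by rw [sC x hx]; exact cγ⟩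
  · intro x hx
    by_contra hn
    simp only [Set.mem_union, not_or] at hn
    exact hx (s0' x hn.1.1 hn.1.2 hn.2)
  · intro z3
    have k1 : Integrable (fun x => s x * f x ^ 2) unitInt := hdir.int2 fL
    have k2 : Integrable (fun x => (s0 + t0) * (s x * f x)) unitInt :=
      (hdir.mulL2 fL).int.const_mul _
    have k3 : Integrable (fun x => (s0 * t0) * s x) unitInt := hdir.int.const_mul _
    have k12 : Integrable (fun x => s x * f x ^ 2 - (s0 + t0) * (s x * f x)) unitInt := k1.sub k2
    have k : Integrable (fun x => s x * f x ^ 2 - (s0 + t0) * (s x * f x) + (s0 * t0) * s x)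
      unitInt := k12.add k3
    have e : ∫ x, (s x * f x ^ 2 - (s0 + t0) * (s x * f x) + (s0 * t0) * s x) ∂unitInt = 0 := by
      rw [integral_add k12 k3, integral_sub k1 k2, integral_const_mul, integral_const_mul, z1, z2,
        z3]; ring
    have e2 : ∀ x, s x * f x ^ 2 - (s0 + t0) * (s x * f x) + (s0 * t0) * s x
        = s x * ((f x - s0) * (f x - t0)) := fun x => by ring
    have pos : ∀ x ∈ A, 0 < s x * ((f x - s0) * (f x - t0)) := by
      intro x h1
      rw [sA x h1]
      exact mul_pos cα (mul_pos_of_neg_of_neg (by linarith [hA x h1]) (by linarith [hA x h1]))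
    have := int_pos (A := A) k (fun x => ?_) (fun x hx => by rw [e2]; exact pos x hx) pA
    · linarith
    · rw [e2]
      by_cases h1 : x ∈ A
      · exact (pos x h1).le
      by_cases h2 : x ∈ B
      · rw [sB x h2]
        have := hB x h2
        have h5 := mul_pos (sub_pos.2 this.1) (sub_pos.2 this.2)
        nlinarith
      by_cases h3 : x ∈ C
      · rw [sC x h3]
        have := hC x h3
        exact (mul_pos cγ (mul_pos (by linarith) (by linarith))).le
      rw [s0' x h1 h2 h3]; simp

end GS

namespace GS
open Filter Topology

/-- first use: no three values on a set where the kernel vanishes -/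
lemma Nice.no_three {S f g C0} (N : Nice S f g C0)
    {A B C : Set ℝ} (mA : MeasurableSet A) (mB : MeasurableSet B) (mC : MeasurableSet C)
    (pA : unitInt A ≠ 0) (pB : unitInt B ≠ 0) (pC : unitInt C ≠ 0) {s0 t0 : ℝ} (hs0 : 0 < s0)
    (hst : s0 < t0)
    (hA : ∀ x ∈ A, f x < s0) (hB : ∀ x ∈ B, s0 < f x ∧ f x < t0) (hC : ∀ x ∈ C, t0 < f x)
    (hg : ∀ x ∈ A ∪ B ∪ C, 0 < g x)
    (hK : ∀ x ∈ A ∪ B ∪ C, ∀ y ∈ A ∪ B ∪ C, f x * f y ≤ g x * g y) : False := by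
  have hO := N.opt
  obtain ⟨s, hd, h1, h2, h3, -⟩ :=
    three_sets hO.fL.1 N.bf N.pos mA mB mC pA pB pC hs0 hst hA hB hC
  have hz : ∀ φ : ℝ → ℝ, EE (K0 f g) (fun x => s x * φ x) (fun x => s x * φ x) = 0 := by
    intro φ
    unfold EE
    refine integral_eq_zero_of_ae (Eventually.of_forall fun p => ?_)
    simp only [Pi.zero_apply]
    by_cases a1 : s p.1 = 0
    · rw [a1]; ring
    by_cases a2 : s p.2 = 0
    · rw [a2]; ring
    have : K0 f g p.1 p.2 = 0 := if_neg (not_lt.2 (hK _ (h2 _ a1) _ (h2 _ a2)))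
    rw [this]; ring
  have h4 := N.second_eq hd h1 (hz f) (hz g)
  have hneg := freq_neg N.pos hO.fL hO.gL hO.g1 (hO.orth N.hB N.hS)
  obtain ⟨x, hx, hx2⟩ := (hneg.and_eventually h4).exists
  refine h3 ?_
  rw [← hx2]
  unfold op
  congr 1; ext y
  by_cases a : s y = 0
  · simp [a]
  have : K0 f g x y = 1 := if_pos
    ((mul_neg_of_neg_of_pos hx (hg y (h2 y a))).trans (mul_pos (N.pos x) (N.pos y)))
  rw [this, one_mul]

/-- second use -/
lemma Nice.no_three' {S f g C0} (N : Nice S f g C0)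
    {A B C : Set ℝ} (mA : MeasurableSet A) (mB : MeasurableSet B) (mC : MeasurableSet C)
    (pA : unitInt A ≠ 0) (pB : unitInt B ≠ 0) (pC : unitInt C ≠ 0) {s0 t0 : ℝ} (hs0 : 0 < s0)
    (hst : s0 < t0)
    (hA : ∀ x ∈ A, f x < s0) (hB : ∀ x ∈ B, s0 < f x ∧ f x < t0) (hC : ∀ x ∈ C, t0 < f x)
    (hK : ∀ x ∈ A ∪ B ∪ C, ∀ y ∈ A ∪ B ∪ C, ¬ (x ∈ C ∧ y ∈ C) → f x * f y ≤ g x * g y)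
    (hK2 : ∀ x ∈ C, ∀ y ∈ C, g x * g y < f x * f y) : False := by
  have hO := N.opt
  obtain ⟨s, hd, h1, h2, -, h4⟩ :=
    three_sets hO.fL.1 N.bf N.pos mA mB mC pA pB pC hs0 hst hA hB hC
  have h5 := N.second_le hd h1
  rw [J_eq hO.gr.ker (hd.mulL2 hO.fL) (hd.mulL2 hO.gL)] at h5
  have hp : ∀ p : ℝ × ℝ, p.1 ∈ C → p.2 ∈ C → 0 < K0 f g p.1 p.2 *
      (s p.1 * f p.1 * (s p.2 * f p.2) - s p.1 * g p.1 * (s p.2 * g p.2)) := by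
    intro p c1 c2
    have h := hK2 _ c1 _ c2
    have : K0 f g p.1 p.2 = 1 := if_pos h
    rw [this]
    have := mul_pos (mul_pos (h4 _ c1) (h4 _ c2)) (sub_pos.2 h)
    nlinarith
  have hnn : ∀ p : ℝ × ℝ, 0 ≤ K0 f g p.1 p.2 *
      (s p.1 * f p.1 * (s p.2 * f p.2) - s p.1 * g p.1 * (s p.2 * g p.2)) := by
    intro p
    by_cases c : p.1 ∈ C ∧ p.2 ∈ C
    · exact (hp p c.1 c.2).le
    by_cases a1 : s p.1 = 0
    · rw [a1]; simp
    by_cases a2 : s p.2 = 0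
    · rw [a2]; simp
    have : K0 f g p.1 p.2 = 0 := if_neg (not_lt.2 (hK _ (h2 _ a1) _ (h2 _ a2) c))
    rw [this]; simp
  have : 0 < ∫ p, K0 f g p.1 p.2 *
      (s p.1 * f p.1 * (s p.2 * f p.2) - s p.1 * g p.1 * (s p.2 * g p.2))
      ∂(unitInt.prod unitInt) := by
    rw [integral_pos_iff_support_of_nonneg hnn
      (J_int hO.gr.ker (hd.mulL2 hO.fL) (hd.mulL2 hO.gL))]
    refine lt_of_lt_of_le ?_ (measure_mono (s := C ×ˢ C) ?_)
    · rw [Measure.prod_prod]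
      exact pos_iff_ne_zero.2 (mul_ne_zero pC pC)
    · intro p hpc
      exact (hp p hpc.1 hpc.2).ne'
  linarith

/-- The eigenfunction takes at most two values on the set `1 < g, f < 1`. -/
lemma Nice.two_values {S f g C0} (N : Nice S f g C0) :
    ∃ a b, ∀ᵐ x ∂unitInt, 1 < g x → f x < 1 → f x = a ∨ f x = b := by
  have hO := N.opt
  have mf := hO.fL.1
  have mg := hO.gL.1
  set H : Set ℝ := {x | 1 < g x ∧ f x < 1} with hH
  have mH : MeasurableSet H := (measurableSet_lt measurable_const mg).inter
    (measurableSet_lt mf measurable_const)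
  set P := (unitInt.restrict H).map f with hP
  have hsupp : ∀ᵐ x ∂unitInt, x ∈ H → f x ∈ P.support := by
    have h1 : ∀ᵐ y ∂P, y ∈ P.support := Measure.support_mem_ae
    have h2 := ae_of_ae_map mf.aemeasurable h1
    exact (ae_restrict_iff' mH).1 h2
  have hpos : ∀ p ∈ P.support, ∀ l u : ℝ, l < p → p < u → unitInt (H ∩ f ⁻¹' Set.Ioo l u) ≠ 0 := by
    intro p hp l u h1 h2 h0
    have := ((Measure.mem_support_iff_forall p).1 hp) (Set.Ioo l u) (Ioo_mem_nhds h1 h2)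
    rw [hP, Measure.map_apply mf measurableSet_Ioo,
      Measure.restrict_apply (mf measurableSet_Ioo), Set.inter_comm, h0] at this
    exact lt_irrefl _ this
  have hno : ∀ p ∈ P.support, ∀ q ∈ P.support, ∀ r ∈ P.support, p < q → q < r → False := by
    intro p hp q hq r hr hpq hqr
    have hp0 : 0 ≤ p := by
      by_contra hc
      push Not at hc
      refine hpos p hp (p - 1) 0 (by linarith) hc ?_
      have : H ∩ f ⁻¹' Set.Ioo (p - 1) 0 = ∅ := by
        ext x
        simp only [Set.mem_inter_iff, Set.mem_preimage, Set.mem_Ioo, Set.mem_empty_iff_false,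
          iff_false]
        rintro ⟨-, -, h⟩
        linarith [N.pos x]
      rw [this]; simp
    refine N.no_three (s0 := (p + q) / 2) (t0 := (q + r) / 2)
      (mH.inter (mf (measurableSet_Ioo (a := p - 1) (b := (p + q) / 2))))
      (mH.inter (mf (measurableSet_Ioo (a := (p + q) / 2) (b := (q + r) / 2))))
      (mH.inter (mf (measurableSet_Ioo (a := (q + r) / 2) (b := r + 1))))
      (hpos p hp _ _ (by linarith) (by linarith)) (hpos q hq _ _ (by linarith) (by linarith))
      (hpos r hr _ _ (by linarith) (by linarith)) (by linarith) (by linarith)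
      (fun x hx => hx.2.2) (fun x hx => hx.2) (fun x hx => hx.2.1) ?_ ?_
    · rintro x ((hx | hx) | hx) <;> exact zero_lt_one.trans hx.1.1
    · have : ∀ x y, x ∈ H → y ∈ H → f x * f y ≤ g x * g y := by
        intro x y hx hy
        have a := N.pos x
        have b := N.pos y
        have c := hx.1
        have d := hy.1
        have e := hx.2
        have f := hy.2
        nlinarith
      rintro x ((hx | hx) | hx) y ((hy | hy) | hy) <;> exact this x y hx.1 hy.1
  obtain ⟨a, b, hab⟩ : ∃ a b, ∀ p ∈ P.support, p = a ∨ p = b := by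
    by_cases hne : ∃ a, a ∈ P.support
    · obtain ⟨a, ha⟩ := hne
      by_cases hne2 : ∃ b, b ∈ P.support ∧ b ≠ a
      · obtain ⟨b, hb, hba⟩ := hne2
        refine ⟨a, b, fun p hp => ?_⟩
        by_contra hc
        push Not at hc
        rcases lt_or_gt_of_ne hba with h1 | h1 <;> rcases lt_or_gt_of_ne hc.1 with h2 | h2 <;>
          rcases lt_or_gt_of_ne hc.2 with h3 | h3
        · exact hno p hp b hb a ha h3 h1
        · exact hno b hb p hp a ha h3 h2
        · linarith
        · exact hno b hb a ha p hp h1 h2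
        · exact hno p hp a ha b hb h2 h1
        · linarith
        · exact hno a ha p hp b hb h2 h3
        · exact hno a ha b hb p hp h1 h3
      · push Not at hne2
        exact ⟨a, a, fun p hp => Or.inl (hne2 p hp)⟩
    · push Not at hne
      exact ⟨0, 0, fun p hp => absurd hp (hne p)⟩
  refine ⟨a, b, ?_⟩
  filter_upwards [hsupp] with x hx h1 h2
  exact hab _ (hx ⟨h1, h2⟩)

end GS

namespace GS
open Filter Topology

/-- the value of `|g|` on the ellipse -/
noncomputable def Gv (μ ν t : ℝ) : ℝ := Real.sqrt ((μ - ν - μ * t ^ 2) / (-ν))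

lemma Gv_eq {μ ν u v : ℝ} (hν : ν < 0) (h : μ * u ^ 2 - ν * v ^ 2 = μ - ν) (hv : 0 < v) :
    v = Gv μ ν u := by
  unfold Gv
  have : (μ - ν - μ * u ^ 2) / (-ν) = v ^ 2 := by
    rw [div_eq_iff (by linarith)]; linarith
  rw [this, Real.sqrt_sq hv.le]

lemma Gv_anti {μ ν a b : ℝ} (hμ : 0 < μ) (hν : ν < 0) (ha : 0 < a) (hab : a < b) :
    Gv μ ν b ≤ Gv μ ν a := by
  unfold Gv
  refine Real.sqrt_le_sqrt (div_le_div_of_nonneg_right ?_ (by linarith))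
  have : a ^ 2 ≤ b ^ 2 := by nlinarith
  nlinarith

lemma ell_hi {μ ν u v : ℝ} (hμ : 0 < μ) (hν : ν < 0) (h : μ * u ^ 2 - ν * v ^ 2 = μ - ν)
    (hu : 0 < u) (hv : 1 < v) : u < 1 := by
  by_contra hc
  push Not at hc
  have h1 : 1 ≤ u ^ 2 := by nlinarith
  have h2 : 1 < v ^ 2 := by nlinarith
  have h3 : ν * v ^ 2 < ν := by nlinarith
  have h4 : μ ≤ μ * u ^ 2 := by nlinarith
  linarith

lemma ell_lo {μ ν u v : ℝ} (hμ : 0 < μ) (hν : ν < 0) (h : μ * u ^ 2 - ν * v ^ 2 = μ - ν)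
    (hu : 0 < u) (hv0 : 0 < v) (hv : v < 1) : 1 < u := by
  by_contra hc
  push Not at hc
  have h1 : u ^ 2 ≤ 1 := by nlinarith
  have h2 : v ^ 2 < 1 := by nlinarith
  have h3 : ν < ν * v ^ 2 := by nlinarith
  have h4 : μ * u ^ 2 ≤ μ := by nlinarith
  linarith

lemma Nice.g_ne_one {S f g C0} (N : Nice S f g C0) : ∀ᵐ x ∂unitInt, g x ≠ 1 := by
  have hO := N.opt
  have hmu := hO.mu_pos N.hB N.hS
  have hell := N.ellipse
  have ht := hO.ties N.hB N.hS N.pos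
  generalize EE (K0 f g) f f = μ at *
  generalize EE (K0 f g) g g = ν at *
  set Z : Set ℝ := {x | g x = 1 ∧ f x = 1} with hZ
  have h0 : (unitInt.prod unitInt) (Z ×ˢ Z) = 0 := by
    refine measure_mono_null ?_ (ae_iff.1 ht)
    rintro p ⟨h1, h2⟩ h3
    exact h3 (by rw [h1.1]; norm_num) (by rw [h2.1]; norm_num) (by rw [h1.1, h2.1, h1.2, h2.2])
  rw [Measure.prod_prod] at h0
  have hZ0 : unitInt Z = 0 := by simpa using h0
  have hae : ∀ᵐ x ∂unitInt, x ∉ Z := measure_eq_zero_iff_ae_notMem.1 hZ0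
  filter_upwards [hell, hae] with x h1 h2 h3
  refine h2 ⟨h3, ?_⟩
  rw [h3] at h1
  have : μ * (f x ^ 2 - 1) = 0 := by linarith
  have h5 := (mul_eq_zero.1 this).resolve_left hmu.ne'
  have : (f x - 1) * (f x + 1) = 0 := by linarith
  rcases mul_eq_zero.1 this with h | h
  · linarith
  · linarith [N.pos x]

lemma Nice.low {S f g C0} (N : Nice S f g C0) {a b : ℝ} (hab : a < b)
    (pa : unitInt {x | 1 < g x ∧ f x = a} ≠ 0) (pb : unitInt {x | 1 < g x ∧ f x = b} ≠ 0) :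
    ∀ᵐ x ∂unitInt, 0 < g x → g x < 1 →
      g x * Gv (EE (K0 f g) f f) (EE (K0 f g) g g) b < f x * b := by
  have hO := N.opt
  have mf := hO.fL.1
  have mg := hO.gL.1
  have hmu := hO.mu_pos N.hB N.hS
  have hnu := hO.nu_neg N.hS
  have hell := N.ellipse
  generalize EE (K0 f g) f f = μ at *
  generalize EE (K0 f g) g g = ν at *
  set E : Set ℝ := {x | μ * f x ^ 2 - ν * g x ^ 2 = μ - ν} with hE
  have mE : MeasurableSet E := measurableSet_eq_fun
    (((mf.pow_const 2).const_mul μ).sub ((mg.pow_const 2).const_mul ν)) measurable_const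
  have nE : unitInt Eᶜ = 0 := hell
  have drop : ∀ T : Set ℝ, unitInt T ≠ 0 → unitInt (T ∩ E) ≠ 0 := by
    intro T hT h0
    refine hT (measure_mono_null (t := (T ∩ E) ∪ Eᶜ) ?_ (measure_union_null h0 nE))
    intro x hx
    by_cases h : x ∈ E
    · exact Or.inl ⟨hx, h⟩
    · exact Or.inr h
  have mcl : ∀ t : ℝ, MeasurableSet {x | 1 < g x ∧ f x = t} := fun t =>
    (measurableSet_lt measurable_const mg).inter (mf (measurableSet_singleton t))
  have hcl : ∀ t x, x ∈ {x | 1 < g x ∧ f x = t} ∩ E →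
      0 < t ∧ t < 1 ∧ f x = t ∧ g x = Gv μ ν t ∧ 1 < g x := by
    rintro t x ⟨⟨h1, h2⟩, h3⟩
    have h4 : f x < 1 := ell_hi hmu hnu h3 (N.pos x) h1
    refine ⟨h2 ▸ N.pos x, h2 ▸ h4, h2, ?_, h1⟩
    rw [← h2]
    exact Gv_eq hnu h3 (by linarith)
  set L : Set ℝ := {x | 0 < g x ∧ g x < 1 ∧ f x * b ≤ g x * Gv μ ν b} with hL
  have mL : MeasurableSet L := (measurableSet_lt measurable_const mg).inter
    ((measurableSet_lt mg measurable_const).inter (measurableSet_le (mf.mul_const b)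
      (mg.mul_const _)))
  have key : unitInt L = 0 := by
    by_contra hc
    have qa := drop _ pa
    have qb := drop _ pb
    have qL := drop _ hc
    obtain ⟨xa, hxa⟩ := nonempty_of_measure_ne_zero qa
    obtain ⟨xb, hxb⟩ := nonempty_of_measure_ne_zero qb
    have fa := hcl a xa hxa
    have fb := hcl b xb hxb
    have hG := Gv_anti hmu hnu fa.1 hab
    have hGb : 1 < Gv μ ν b := by rw [← fb.2.2.2.1]; exact fb.2.2.2.2
    have hlo : ∀ x ∈ L ∩ E, 1 < f x := fun x hx =>
      ell_lo hmu hnu hx.2 (N.pos x) hx.1.1 hx.1.2.1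
    -- kernel between H and H
    have HH : ∀ x y, 1 < g x → 1 < g y → f x < 1 → f y < 1 → f x * f y ≤ g x * g y := by
      intro x y h1 h2 h3 h4
      have a := N.pos x
      have b := N.pos y
      nlinarith
    have aL : ∀ x ∈ {x | 1 < g x ∧ f x = a} ∩ E, ∀ y ∈ L ∩ E, f x * f y ≤ g x * g y := by
      intro x hx y hy
      have h := hcl a x hx
      rw [h.2.2.1, h.2.2.2.1]
      have h1 := hy.1.2.2
      have h2 := hy.1.1
      have h3 := N.pos y
      nlinarith
    have bL : ∀ x ∈ {x | 1 < g x ∧ f x = b} ∩ E, ∀ y ∈ L ∩ E, f x * f y ≤ g x * g y := by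
      intro x hx y hy
      have h := hcl b x hx
      rw [h.2.2.1, h.2.2.2.1]
      have h1 := hy.1.2.2
      linarith
    refine N.no_three' (s0 := (a + b) / 2) (t0 := 1) ((mcl a).inter mE) ((mcl b).inter mE)
      (mL.inter mE) qa qb qL (by linarith [fa.1]) (by linarith [fa.2.1, fb.2.1]) ?_ ?_ hlo ?_ ?_
    · intro x hx; rw [hx.1.2]; linarith
    · intro x hx; rw [hx.1.2]; exact ⟨by linarith, fb.2.1⟩
    · have hi : ∀ t x, x ∈ {x | 1 < g x ∧ f x = t} ∩ E → 1 < g x ∧ f x < 1 := by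
        intro t x hx
        have := hcl t x hx
        exact ⟨this.2.2.2.2, by rw [this.2.2.1]; exact this.2.1⟩
      rintro x ((hx | hx) | hx) y ((hy | hy) | hy) hn
      · exact HH x y (hi _ _ hx).1 (hi _ _ hy).1 (hi _ _ hx).2 (hi _ _ hy).2
      · exact HH x y (hi _ _ hx).1 (hi _ _ hy).1 (hi _ _ hx).2 (hi _ _ hy).2
      · exact aL x hx y hy
      · exact HH x y (hi _ _ hx).1 (hi _ _ hy).1 (hi _ _ hx).2 (hi _ _ hy).2
      · exact HH x y (hi _ _ hx).1 (hi _ _ hy).1 (hi _ _ hx).2 (hi _ _ hy).2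
      · exact bL x hx y hy
      · rw [mul_comm (f x), mul_comm (g x)]; exact aL y hy x hx
      · rw [mul_comm (f x), mul_comm (g x)]; exact bL y hy x hx
      · exact absurd ⟨hx, hy⟩ hn
    · intro x hx y hy
      have h1 := hlo x hx
      have h2 := hlo y hy
      have h3 := hx.1.1
      have h4 := hx.1.2.1
      have h5 := hy.1.1
      have h6 := hy.1.2.1
      nlinarith
  have hae : ∀ᵐ x ∂unitInt, x ∉ L := measure_eq_zero_iff_ae_notMem.1 key
  filter_upwards [hae] with x hx h1 h2
  by_contra hc
  push Not at hc
  exact hx ⟨h1, h2, hc⟩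

lemma Nice.struct {S f g C0} (N : Nice S f g C0) : ∃ (Q : Prop) (a b : ℝ),
    ∀ᵐ x ∂unitInt, (1 < g x → f x = a ∨ (Q ∧ f x = b)) ∧ (Q → 0 < g x → g x < 1 →
      g x * Gv (EE (K0 f g) f f) (EE (K0 f g) g g) b < f x * b) := by
  obtain ⟨a, b, hab⟩ := N.two_values
  have hO := N.opt
  have hmu := hO.mu_pos N.hB N.hS
  have hnu := hO.nu_neg N.hS
  have hell := N.ellipse
  have h2 : ∀ᵐ x ∂unitInt, 1 < g x → f x = a ∨ f x = b := by
    filter_upwards [hab, hell] with x h1 h3 h4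
    exact h1 h4 (ell_hi hmu hnu h3 (N.pos x) h4)
  by_cases pa : unitInt {x | 1 < g x ∧ f x = a} = 0
  · refine ⟨False, b, b, ?_⟩
    have hae : ∀ᵐ x ∂unitInt, x ∉ {x | 1 < g x ∧ f x = a} := measure_eq_zero_iff_ae_notMem.1 pa
    filter_upwards [h2, hae] with x h1 h3
    refine ⟨fun h4 => ?_, fun h => h.elim⟩
    rcases h1 h4 with h | h
    · exact absurd ⟨h4, h⟩ h3
    · exact Or.inl h
  by_cases pb : unitInt {x | 1 < g x ∧ f x = b} = 0
  · refine ⟨False, a, a, ?_⟩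
    have hae : ∀ᵐ x ∂unitInt, x ∉ {x | 1 < g x ∧ f x = b} := measure_eq_zero_iff_ae_notMem.1 pb
    filter_upwards [h2, hae] with x h1 h3
    refine ⟨fun h4 => ?_, fun h => h.elim⟩
    rcases h1 h4 with h | h
    · exact Or.inl h
    · exact absurd ⟨h4, h⟩ h3
  rcases lt_trichotomy a b with c | c | c
  · refine ⟨True, a, b, ?_⟩
    filter_upwards [h2, N.low c pa pb] with x h1 h3
    exact ⟨fun h => (h1 h).imp id (fun h => ⟨trivial, h⟩), fun _ => h3⟩
  · refine ⟨False, a, a, ?_⟩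
    filter_upwards [h2] with x h1
    exact ⟨fun h => Or.inl ((h1 h).elim id (fun h => h.trans c.symm)), fun h => h.elim⟩
  · refine ⟨True, b, a, ?_⟩
    filter_upwards [h2, N.low c pb pa] with x h1 h3
    exact ⟨fun h => (h1 h).symm.imp id (fun h => ⟨trivial, h⟩), fun _ => h3⟩

/-- the pattern on one sign class -/
def M4 : Fin 4 → Fin 4 → ℝ :=
  ![![1, 1, 1, 1], ![1, 1, 1, 0], ![1, 1, 0, 0], ![1, 0, 0, 0]]

lemma M4_symm (i j : Fin 4) : M4 i j = M4 j i := by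
  fin_cases i <;> fin_cases j <;> simp [M4]

lemma Nice.side {S f g C0} (N : Nice S f g C0) : ∃ c : ℝ → Fin 4, Measurable c ∧
    ∀ᵐ p : ℝ × ℝ ∂(unitInt.prod unitInt), 0 < g p.1 → 0 < g p.2 →
      K0 f g p.1 p.2 = M4 (c p.1) (c p.2) := by
  classical
  obtain ⟨Q, a, b, hst⟩ := N.struct
  have hO := N.opt
  have mf := hO.fL.1
  have mg := hO.gL.1
  have hmu := hO.mu_pos N.hB N.hS
  have hnu := hO.nu_neg N.hS
  have hell := N.ellipse
  generalize EE (K0 f g) f f = μ at *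
  generalize EE (K0 f g) g g = ν at *
  set c : ℝ → Fin 4 := fun x => if 1 < g x then (if f x = a then 3 else 2)
    else (if g x * Gv μ ν a < f x * a then 0 else 1) with hc
  have mc : Measurable c := by
    refine Measurable.ite (measurableSet_lt measurable_const mg) ?_ ?_
    · exact Measurable.ite (mf (measurableSet_singleton a)) measurable_const measurable_const
    · exact Measurable.ite (measurableSet_lt (mg.mul_const _) (mf.mul_const a)) measurable_const
        measurable_const
  refine ⟨c, mc, ?_⟩
  have good := (hst.and hell).and N.g_ne_one
  -- mixed block
  have mixed : ∀ x y, (((1 < g x → f x = a ∨ (Q ∧ f x = b)) ∧ (Q → 0 < g x → g x < 1 →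
      g x * Gv μ ν b < f x * b)) ∧ μ * f x ^ 2 - ν * g x ^ 2 = μ - ν) ∧ g x ≠ 1 →
      (((1 < g y → f y = a ∨ (Q ∧ f y = b)) ∧ (Q → 0 < g y → g y < 1 →
      g y * Gv μ ν b < f y * b)) ∧ μ * f y ^ 2 - ν * g y ^ 2 = μ - ν) ∧ g y ≠ 1 →
      1 < g x → 0 < g y → g y < 1 → K0 f g x y = M4 (c x) (c y) := by
    rintro x y ⟨⟨⟨x1, -⟩, x3⟩, -⟩ ⟨⟨⟨-, y2⟩, y3⟩, -⟩ h1 h2 h3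
    have hG := Gv_eq hnu x3 (by linarith)
    have hny : ¬ 1 < g y := not_lt.2 h3.le
    by_cases e : f x = a
    · have cx : c x = 3 := by simp [hc, h1, e]
      by_cases d : g y * Gv μ ν a < f y * a
      · have cy : c y = 0 := by simp [hc, hny, d]
        rw [cx, cy]
        have : g x * g y < f x * f y := by
          rw [hG, e]; linarith
        rw [K0, if_pos this]; simp [M4]
      · have cy : c y = 1 := by simp [hc, hny, d]
        rw [cx, cy]
        have : ¬ g x * g y < f x * f y := by
          rw [hG, e]; intro h; exact d (by linarith)
        rw [K0, if_neg this]; simp [M4]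
    · have cx : c x = 2 := by simp [hc, h1, e]
      obtain ⟨q, e2⟩ := (x1 h1).resolve_left e
      have h5 := y2 q h2 h3
      have : g x * g y < f x * f y := by
        rw [hG, e2]; linarith
      rw [K0, if_pos this, cx]
      by_cases d : g y * Gv μ ν a < f y * a
      · have cy : c y = 0 := by simp [hc, hny, d]
        rw [cy]; simp [M4]
      · have cy : c y = 1 := by simp [hc, hny, d]
        rw [cy]; simp [M4]
  filter_upwards [ae_prod_fst good, ae_prod_snd good] with p gx gy h1 h2
  generalize p.1 = x at *
  generalize p.2 = y at *
  rcases lt_or_gt_of_ne gx.2 with hx | hx <;> rcases lt_or_gt_of_ne gy.2 with hy | hy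
  · have a1 := ell_lo hmu hnu gx.1.2 (N.pos x) h1 hx
    have a2 := ell_lo hmu hnu gy.1.2 (N.pos y) h2 hy
    have : g x * g y < f x * f y := by nlinarith
    rw [K0, if_pos this]
    have cx : c x = 0 ∨ c x = 1 := by
      simp only [hc]; rw [if_neg (not_lt.2 hx.le)]; split_ifs <;> simp
    have cy : c y = 0 ∨ c y = 1 := by
      simp only [hc]; rw [if_neg (not_lt.2 hy.le)]; split_ifs <;> simp
    rcases cx with e | e <;> rcases cy with e' | e' <;> rw [e, e'] <;> simp [M4]
  · rw [K0_symm, M4_symm]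
    exact mixed y x gy gx hy h1 hx
  · exact mixed x y gx gy hx h2 hy
  · have a1 := ell_hi hmu hnu gx.1.2 (N.pos x) hx
    have a2 := ell_hi hmu hnu gy.1.2 (N.pos y) hy
    have : ¬ g x * g y < f x * f y := by
      have a3 := N.pos x
      have a4 := N.pos y
      rw [not_lt]; nlinarith
    rw [K0, if_neg this]
    have cx : c x = 2 ∨ c x = 3 := by
      simp only [hc]; rw [if_pos hx]; split_ifs <;> simp
    have cy : c y = 2 ∨ c y = 3 := by
      simp only [hc]; rw [if_pos hy]; split_ifs <;> simp
    rcases cx with e | e <;> rcases cy with e' | e' <;> rw [e, e'] <;> simp [M4]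

end GS

namespace GS
open Filter Topology

/-- labels for the positive side -/
def lP : Fin 4 → Fin 7 := ![0, 1, 2, 3]

/-- labels for the negative side -/
def lN : Fin 4 → Fin 7 := ![0, 4, 5, 6]

lemma step_PP (i j : Fin 4) : stepMatrix (lP i) (lP j) = M4 i j := by
  fin_cases i <;> fin_cases j <;> simp [stepMatrix, lP, M4]

lemma step_NN (i j : Fin 4) : stepMatrix (lN i) (lN j) = M4 i j := by
  fin_cases i <;> fin_cases j <;> simp [stepMatrix, lN, M4]

lemma step_PN (i j : Fin 4) : stepMatrix (lP i) (lN j) = 1 := by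
  fin_cases i <;> fin_cases j <;> simp [stepMatrix, lP, lN]

lemma step_NP (i j : Fin 4) : stepMatrix (lN i) (lP j) = 1 := by
  fin_cases i <;> fin_cases j <;> simp [stepMatrix, lP, lN]

lemma step_0l (i : Fin 7) : stepMatrix 0 i = 1 := by
  fin_cases i <;> simp [stepMatrix]

lemma step_0r (i : Fin 7) : stepMatrix i 0 = 1 := by
  fin_cases i <;> simp [stepMatrix]

lemma K0_neg (f g : ℝ → ℝ) : K0 f (fun x => - g x) = K0 f g := by
  ext x y; simp [K0]

lemma Nice.neg {S f g C0} (N : Nice S f g C0) : Nice S f (fun x => - g x) C0 :=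
  ⟨N.hB, N.hS, by rw [K0_neg]; exact N.opt.neg, N.pos, N.bf, fun x => by simpa using N.bg x⟩

lemma Nice.final {S f g C0} (N : Nice S f g C0) : ∃ c : ℝ → Fin 7, Measurable c ∧
    ∀ᵐ p : ℝ × ℝ ∂(unitInt.prod unitInt), K0 f g p.1 p.2 = stepMatrix (c p.1) (c p.2) := by
  classical
  obtain ⟨cP, mP, hP⟩ := N.side
  obtain ⟨cN, mN, hN⟩ := N.neg.side
  rw [K0_neg] at hN
  have mg := N.opt.gL.1
  set c : ℝ → Fin 7 := fun x => if 0 < g x then lP (cP x) else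
    (if g x < 0 then lN (cN x) else 0) with hc
  have mc : Measurable c := by
    refine Measurable.ite (measurableSet_lt measurable_const mg) ?_ ?_
    · exact (measurable_of_finite lP).comp mP
    · exact Measurable.ite (measurableSet_lt mg measurable_const)
        ((measurable_of_finite lN).comp mN) measurable_const
  refine ⟨c, mc, ?_⟩
  filter_upwards [hP, hN] with p h1 h2
  generalize p.1 = x at *
  generalize p.2 = y at *
  have hff := mul_pos (N.pos x) (N.pos y)
  have e1 : ∀ z, 0 < g z → c z = lP (cP z) := fun z hz => if_pos hz
  have e2 : ∀ z, g z < 0 → c z = lN (cN z) := fun z hz => by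
    simp only [hc]; rw [if_neg (not_lt.2 hz.le), if_pos hz]
  have e3 : ∀ z, g z = 0 → c z = 0 := fun z hz => by simp [hc, hz]
  rcases lt_trichotomy (g x) 0 with hx | hx | hx
  · rcases lt_trichotomy (g y) 0 with hy | hy | hy
    · rw [e2 x hx, e2 y hy, step_NN]
      exact h2 (by linarith) (by linarith)
    · rw [e3 y hy, step_0r]
      exact if_pos (by rw [hy]; simpa using hff)
    · rw [e2 x hx, e1 y hy, step_NP]
      exact if_pos ((mul_neg_of_neg_of_pos hx hy).trans hff)
  · rw [e3 x hx, step_0l]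
    exact if_pos (by rw [hx]; simpa using hff)
  · rcases lt_trichotomy (g y) 0 with hy | hy | hy
    · rw [e1 x hx, e2 y hy, step_PN]
      exact if_pos ((mul_neg_of_pos_of_neg hx hy).trans hff)
    · rw [e3 y hy, step_0r]
      exact if_pos (by rw [hy]; simpa using hff)
    · rw [e1 x hx, e1 y hy, step_PP]
      exact h1 hx hy

end GS

/-- Any spread-maximal graphon is a `{0,1}`-valued stepfunction with at most seven
steps, following the pattern `stepMatrix`. -/
theorem graphon_reduction_to_stepgraphon (W : ℝ → ℝ → ℝ) (hW : IsGraphon W)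
    (hmax : ∀ U : ℝ → ℝ → ℝ, IsGraphon U → graphonSpr U ≤ graphonSpr W) :
    ∃ I : Fin 7 → Set ℝ,
      (∀ i, MeasurableSet (I i)) ∧
      (Pairwise fun i j => Disjoint (I i) (I j)) ∧
      (⋃ i, I i) = Set.Icc (0 : ℝ) 1 ∧
      (∀ i j, ∀ᵐ p : ℝ × ℝ ∂(volume.restrict ((I i) ×ˢ (I j))),
        W p.1 p.2 = stepMatrix i j) := by
  classical
  obtain ⟨S, f0, g0, hS, hB, h0⟩ := GS.exists_opt hW hmax
  obtain ⟨f, g, C, h1, hpos, bf, bg⟩ := GS.exists_nice hB hS h0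
  have N : GS.Nice S f g C := ⟨hB, hS, h1.K0 hB, hpos, bf, bg⟩
  obtain ⟨c, mc, hc⟩ := N.final
  have hWK := h1.eq_K0 hB hS hpos
  refine ⟨fun i => Set.Icc (0:ℝ) 1 ∩ c ⁻¹' {i}, ?_, ?_, ?_, ?_⟩
  · intro i
    exact measurableSet_Icc.inter (mc (measurableSet_singleton i))
  · intro i j hij
    rw [Set.disjoint_left]
    rintro x ⟨-, hx⟩ ⟨-, hy⟩
    exact hij (hx.symm.trans hy)
  · ext x
    simp
  · intro i j
    have hae : ∀ᵐ p : ℝ × ℝ ∂unitSq, W p.1 p.2 = stepMatrix (c p.1) (c p.2) := by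
      rw [GS.unitSq_eq]
      filter_upwards [hWK, hc] with p a b
      rw [a, b]
    have hsub : (Set.Icc (0:ℝ) 1 ∩ c ⁻¹' {i}) ×ˢ (Set.Icc (0:ℝ) 1 ∩ c ⁻¹' {j})
        ⊆ Set.Icc (0:ℝ) 1 ×ˢ Set.Icc (0:ℝ) 1 :=
      Set.prod_mono Set.inter_subset_left Set.inter_subset_left
    have hms : MeasurableSet ((Set.Icc (0:ℝ) 1 ∩ c ⁻¹' {i}) ×ˢ (Set.Icc (0:ℝ) 1 ∩ c ⁻¹' {j})) :=
      (measurableSet_Icc.inter (mc (measurableSet_singleton i))).prod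
        (measurableSet_Icc.inter (mc (measurableSet_singleton j)))
    filter_upwards [ae_restrict_of_ae_restrict_of_subset hsub hae, ae_restrict_mem hms]
      with p a b
    have b1 : c p.1 = i := b.1.2
    have b2 : c p.2 = j := b.2.2
    rw [a, b1, b2]
end
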